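/- Let n ≥ 2. There exists ε > 0 with the following property: if u₀ : S¹ → S^{n−1} and u, v are energy-class solutions of the half-harmonic gradient flow with initial datum u₀ which additionally satisfy u(t,·) ∈ H¹(S¹) and v(t,·) ∈ H¹(S¹) for a.e. t ≥ 0, and ‖u(t,·)‖_{Ḣ^{1/2}} ≤ ε and ‖v(t,·)‖_{Ḣ^{1/2}} ≤ ε for a.e. t ≥ 0, then u = v almost everywhere on [0,∞)×S¹. -/

import Mathlib

open MeasureTheory Real Filter
open scoped BigOperators ENNReal Real Topology

noncomputable section

/-- Chord distance on `S¹ ≃ ℝ/2πℤ`: `|x-y| = 2|sin((x-y)/2)|`. -/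
def cd (x y : ℝ) : ℝ := 2 * |Real.sin ((x - y) / 2)|

/-- Fundamental domain for the circle `S¹ ≃ ℝ/2πℤ`. -/
def circ : Set ℝ := Set.Ioc (-π) π

/-- `k`-th Fourier coefficient of a `2π`-periodic function `ℝ → ℂ`. -/
def fc (f : ℝ → ℂ) (k : ℤ) : ℂ :=
  ((1 / (2 * π) : ℝ) : ℂ) * ∫ x in circ, f x * Complex.exp (-(Complex.I * (k : ℂ) * (x : ℂ)))

/-- Fourier coefficient of a real-valued function. -/
def fcR (f : ℝ → ℝ) (k : ℤ) : ℂ := fc (fun x => (f x : ℂ)) k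

/-- `ℝⁿ` as a Euclidean space. -/
abbrev E (n : ℕ) := EuclideanSpace ℝ (Fin n)

/-- Componentwise Fourier coefficients of a vector-valued map. -/
def fcV {n : ℕ} (u : ℝ → E n) (k : ℤ) (i : Fin n) : ℂ := fcR (fun x => u x i) k

/-- Squared homogeneous `Ḣ^{1/2}` seminorm: `∑_k |k| |û(k)|²` (valued in `[0,∞]`). -/
def hHalf {n : ℕ} (u : ℝ → E n) : ℝ≥0∞ :=
  ∑' k : ℤ, (k.natAbs : ℝ≥0∞) * ∑ i, (‖fcV u k i‖₊ : ℝ≥0∞) ^ 2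

/-- Squared inhomogeneous `H^s` norm: `∑_k (1+k²)^s |û(k)|²` (valued in `[0,∞]`). -/
def hSob {n : ℕ} (s : ℝ) (u : ℝ → E n) : ℝ≥0∞ :=
  ∑' k : ℤ, ENNReal.ofReal ((1 + (k : ℝ) ^ 2) ^ s) * ∑ i, (‖fcV u k i‖₊ : ℝ≥0∞) ^ 2

/-- Squared homogeneous `Ḣ^{1/2}` seminorm of a scalar function. -/
def hHalfR (f : ℝ → ℝ) : ℝ≥0∞ :=
  ∑' k : ℤ, (k.natAbs : ℝ≥0∞) * (‖fcR f k‖₊ : ℝ≥0∞) ^ 2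

/-- Squared inhomogeneous `H^s` norm of a scalar function. -/
def hSobR (s : ℝ) (f : ℝ → ℝ) : ℝ≥0∞ :=
  ∑' k : ℤ, ENNReal.ofReal ((1 + (k : ℝ) ^ 2) ^ s) * (‖fcR f k‖₊ : ℝ≥0∞) ^ 2

/-- `|d_{1/2}u|²(x) = ∫_{S¹} |u(x)-u(y)|²/|x-y|² dy`. -/
def gagl {n : ℕ} (u : ℝ → E n) (x : ℝ) : ℝ :=
  ∫ y in circ, (∑ i, (u x i - u y i) ^ 2) / cd x y ^ 2

/-- `∫_{S¹}∫_{S¹} d_{1/2}u(x,y)·d_{1/2}φ(x,y) dy dx/|x-y|`. -/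
def pairing {n : ℕ} (u φ : ℝ → E n) : ℝ :=
  ∫ x in circ, ∫ y in circ, (∑ i, (u x i - u y i) * (φ x i - φ y i)) / cd x y ^ 2

/-- The product measure on `(0,∞) × S¹`. -/
def STmeasure : Measure (ℝ × ℝ) :=
  (volume.restrict (Set.Ioi (0 : ℝ))).prod (volume.restrict circ)

/-- Smooth test functions on `(0,∞) × S¹`, compactly supported in time. -/
structure IsSTTest (n : ℕ) (φ : ℝ → ℝ → E n) : Prop where
  smooth : ContDiff ℝ (⊤ : ℕ∞) (fun p : ℝ × ℝ => φ p.1 p.2)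
  periodic : ∀ t, Function.Periodic (φ t) (2 * π)
  suppTime : ∃ a b : ℝ, 0 < a ∧ ∀ t, t ∉ Set.Icc a b → ∀ x, φ t x = 0

/-- Energy-class solution of the half-harmonic gradient flow, with explicit
weak time derivative `w`. -/
structure IsEnergySolAux (n : ℕ) (u₀ : ℝ → E n) (u w : ℝ → ℝ → E n) : Prop where
  meas : Measurable (Function.uncurry u)
  periodic : ∀ t, Function.Periodic (u t) (2 * π)
  sphere : ∀ᵐ p ∂STmeasure, ‖u p.1 p.2‖ = 1
  energyBdd : ∃ M : ℝ≥0∞, M < ⊤ ∧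
    ∀ᵐ t ∂(volume.restrict (Set.Ioi (0 : ℝ))), hHalf (u t) ≤ M
  wMeas : Measurable (Function.uncurry w)
  wL2 : (∫⁻ t in Set.Ioi (0 : ℝ), ∫⁻ x in circ, (‖w t x‖₊ : ℝ≥0∞) ^ 2) < ⊤
  weakDeriv : ∀ φ : ℝ → ℝ → E n, IsSTTest n φ →
    (∫ t in Set.Ioi (0 : ℝ), ∫ x in circ, ∑ i, u t x i * deriv (fun s => φ s x i) t)
      = - ∫ t in Set.Ioi (0 : ℝ), ∫ x in circ, ∑ i, w t x i * φ t x i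
  flow : ∀ φ : ℝ → ℝ → E n, IsSTTest n φ →
    (∫ t in Set.Ioi (0 : ℝ), ∫ x in circ, ∑ i, w t x i * φ t x i)
      + (∫ t in Set.Ioi (0 : ℝ), pairing (u t) (φ t))
      = ∫ t in Set.Ioi (0 : ℝ), ∫ x in circ, gagl (u t) x * ∑ i, u t x i * φ t x i
  init : Tendsto (fun t => ∫⁻ x in circ, (‖u t x - u₀ x‖₊ : ℝ≥0∞) ^ 2)
      (nhdsWithin 0 (Set.Ioi 0)) (nhds 0)

/-- Energy-class solution of the half-harmonic gradient flow. -/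
def IsEnergySol (n : ℕ) (u₀ : ℝ → E n) (u : ℝ → ℝ → E n) : Prop :=
  ∃ w, IsEnergySolAux n u₀ u w

/-- Energy decay: `‖u(t,·)‖_{Ḣ^{1/2}} ≤ ‖u₀‖_{Ḣ^{1/2}}` for a.e. `t ≥ 0`. -/
def EnergyDecay {n : ℕ} (u₀ : ℝ → E n) (u : ℝ → ℝ → E n) : Prop :=
  ∀ᵐ t ∂(volume.restrict (Set.Ioi (0 : ℝ))), hHalf (u t) ≤ hHalf u₀

/-- Fractional Laplacian `(-Δ)^s` of a `2π`-periodic function, via Fourier series. -/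
def fracLapC (s : ℝ) (f : ℝ → ℂ) (x : ℝ) : ℂ :=
  ∑' k : ℤ, (((k.natAbs : ℝ) ^ s : ℝ) : ℂ) * fc f k * Complex.exp (Complex.I * (k : ℂ) * (x : ℂ))

/-- Fractional Laplacian of a real-valued function. -/
def fracLapR (s : ℝ) (f : ℝ → ℝ) (x : ℝ) : ℝ := (fracLapC s (fun y => (f y : ℂ)) x).re

/-- Half-Laplacian of a vector-valued map. -/
def halfLap {n : ℕ} (u : ℝ → E n) (x : ℝ) : E n :=
  (EuclideanSpace.equiv (Fin n) ℝ).symm fun i => fracLapR 1 (fun y => u y i) x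

/-- The integral `C(j,k) = ∫_{-π}^{π} (e^{ijh}-1)(e^{ikh}-1)/(4sin²(h/2)) dh`. -/
def Cjk (j k : ℤ) : ℂ :=
  ∫ h in circ, (Complex.exp (Complex.I * (j : ℂ) * (h : ℂ)) - 1)
      * (Complex.exp (Complex.I * (k : ℂ) * (h : ℂ)) - 1)
      / ((4 * Real.sin (h / 2) ^ 2 : ℝ) : ℂ)

/-- A real trigonometric polynomial: the function equals a finite Fourier sum. -/
def IsTrigPoly (u : ℝ → ℝ) : Prop :=
  ∃ s : Finset ℤ, ∀ x : ℝ,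
    (u x : ℂ) = ∑ k ∈ s, fcR u k * Complex.exp (Complex.I * (k : ℂ) * (x : ℂ))

/-- `d_{1/2}u · d_{1/2}v` as a (complex-valued) function on the circle. -/
def d12prod (u v : ℝ → ℝ) (x : ℝ) : ℂ :=
  ((∫ y in circ, (u x - u y) * (v x - v y) / cd x y ^ 2 : ℝ) : ℂ)

/-- Stereographic projection of `S¹ ∖ {-i}`. -/
def stproj (θ : ℝ) : ℝ := Real.cos θ / (1 + Real.sin θ)

/-- Lebesgue measure on the fundamental domain of the circle. -/
abbrev circMeasure : Measure ℝ := volume.restrict circ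

instance isFiniteMeasure_circMeasure : IsFiniteMeasure circMeasure := by
  unfold circMeasure circ; infer_instance

lemma measurableSet_circ : MeasurableSet circ := measurableSet_Ioc

lemma fc_eq_fourierCoeffOn (f : ℝ → ℂ) (k : ℤ) :
    fc f k = fourierCoeffOn (neg_lt_self pi_pos) f k := by
  rw [fourierCoeffOn_eq_integral, fc, intervalIntegral.integral_of_le (by linarith [pi_pos]),
    Complex.real_smul]
  congr 1
  · norm_num; ring
  · refine integral_congr_ae (ae_of_all _ fun x => ?_)
    simp only [fourier_coe_apply, smul_eq_mul]
    rw [mul_comm]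
    congr 2
    push_cast
    field_simp
    ring

lemma hasSum_sq_fc {f : ℝ → ℂ} (hf : MemLp f 2 circMeasure) :
    HasSum (fun k => ‖fc f k‖ ^ 2) ((2 * π)⁻¹ * ∫ x in circ, ‖f x‖ ^ 2) := by
  have h := hasSum_sq_fourierCoeffOn (neg_lt_self pi_pos) hf
  simp only [← fc_eq_fourierCoeffOn] at h
  convert h using 1
  rw [intervalIntegral.integral_of_le (by linarith [pi_pos]), smul_eq_mul]
  congr 2
  ring

lemma enorm_sq_eq_ofReal {F : Type*} [NormedAddCommGroup F] (z : F) :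
    ‖z‖ₑ ^ 2 = ENNReal.ofReal (‖z‖ ^ 2) := by
  rw [← ofReal_norm, ENNReal.ofReal_pow (norm_nonneg _)]

lemma tsum_enorm_sq_fc {f : ℝ → ℂ} (hf : MemLp f 2 circMeasure) :
    ∑' k, ‖fc f k‖ₑ ^ 2 = ENNReal.ofReal (2 * π)⁻¹ * ∫⁻ x in circ, ‖f x‖ₑ ^ 2 := by
  have h := hasSum_sq_fc hf
  simp only [enorm_sq_eq_ofReal]
  rw [← ENNReal.ofReal_tsum_of_nonneg (fun _ => sq_nonneg _) h.summable, h.tsum_eq,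
    ENNReal.ofReal_mul (by positivity), ofReal_integral_eq_lintegral_ofReal]
  · exact (memLp_two_iff_integrable_sq_norm hf.1).1 hf
  · exact ae_of_all _ fun _ => sq_nonneg _

lemma norm_exp_neg_I_mul (k : ℤ) (x : ℝ) :
    ‖Complex.exp (-(Complex.I * (k : ℂ) * (x : ℂ)))‖ = 1 := by
  rw [show -(Complex.I * (k : ℂ) * (x : ℂ)) = ((-(k * x) : ℝ) : ℂ) * Complex.I by push_cast; ring]
  exact Complex.norm_exp_ofReal_mul_I _

lemma norm_exp_I_mul (k : ℤ) (x : ℝ) :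
    ‖Complex.exp (Complex.I * (k : ℂ) * (x : ℂ))‖ = 1 := by
  rw [show Complex.I * (k : ℂ) * (x : ℂ) = ((k * x : ℝ) : ℂ) * Complex.I by push_cast; ring]
  exact Complex.norm_exp_ofReal_mul_I _

lemma integrable_mul_exp {f : ℝ → ℂ} (hf : Integrable f circMeasure) (k : ℤ) :
    Integrable (fun x => f x * Complex.exp (-(Complex.I * (k : ℂ) * (x : ℂ)))) circMeasure := by
  refine hf.mul_bdd (c := 1) ?_ (ae_of_all _ fun x => (norm_exp_neg_I_mul k x).le)
  exact (by fun_prop : Continuous fun x : ℝ =>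
    Complex.exp (-(Complex.I * (k : ℂ) * (x : ℂ)))).aestronglyMeasurable

lemma fc_add {f g : ℝ → ℂ} (hf : Integrable f circMeasure) (hg : Integrable g circMeasure)
    (k : ℤ) : fc (fun x => f x + g x) k = fc f k + fc g k := by
  simp only [fc, add_mul]
  rw [integral_add (integrable_mul_exp hf k) (integrable_mul_exp hg k), mul_add]

lemma fc_sub {f g : ℝ → ℂ} (hf : Integrable f circMeasure) (hg : Integrable g circMeasure)
    (k : ℤ) : fc (fun x => f x - g x) k = fc f k - fc g k := by
  simp only [fc, sub_mul]
  rw [integral_sub (integrable_mul_exp hf k) (integrable_mul_exp hg k), mul_sub]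

lemma fc_const_mul (c : ℂ) (f : ℝ → ℂ) (k : ℤ) : fc (fun x => c * f x) k = c * fc f k := by
  simp only [fc, mul_assoc, integral_const_mul]
  ring

lemma fcR_add {f g : ℝ → ℝ} (hf : Integrable f circMeasure) (hg : Integrable g circMeasure)
    (k : ℤ) : fcR (fun x => f x + g x) k = fcR f k + fcR g k := by
  simp only [fcR, Complex.ofReal_add]
  exact fc_add hf.ofReal hg.ofReal k

lemma fcR_sub {f g : ℝ → ℝ} (hf : Integrable f circMeasure) (hg : Integrable g circMeasure)
    (k : ℤ) : fcR (fun x => f x - g x) k = fcR f k - fcR g k := by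
  simp only [fcR, Complex.ofReal_sub]
  exact fc_sub hf.ofReal hg.ofReal k

lemma hasSum_sq_fcR {f : ℝ → ℝ} (hf : MemLp f 2 circMeasure) :
    HasSum (fun k => ‖fcR f k‖ ^ 2) ((2 * π)⁻¹ * ∫ x in circ, f x ^ 2) := by
  simpa [fcR] using hasSum_sq_fc hf.ofReal

lemma hasSum_inner_fcR {f g : ℝ → ℝ} (hf : MemLp f 2 circMeasure) (hg : MemLp g 2 circMeasure) :
    HasSum (fun k => (fcR f k * (starRingEnd ℂ) (fcR g k)).re)
      ((2 * π)⁻¹ * ∫ x in circ, f x * g x) := by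
  have hfi := hf.integrable one_le_two
  have hgi := hg.integrable one_le_two
  have h := ((hasSum_sq_fcR (hf.add hg)).sub (hasSum_sq_fcR (hf.sub hg))).mul_left (1 / 4)
  convert! h using 1
  · funext k
    rw [show f + g = fun x => f x + g x from rfl, show f - g = fun x => f x - g x from rfl,
      fcR_add hfi hgi, fcR_sub hfi hgi, Complex.sq_norm, Complex.sq_norm, Complex.normSq_add,
      Complex.normSq_sub]
    ring
  · rw [← mul_sub, ← integral_sub (by simpa using (hf.add hg).integrable_sq)
      (by simpa using (hf.sub hg).integrable_sq), mul_left_comm, ← integral_const_mul (1 / 4)]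
    congr 1
    refine integral_congr_ae (ae_of_all _ fun x => ?_)
    simp only [Pi.add_apply, Pi.sub_apply]
    ring

/-- A square integrable function on the circle with vanishing Fourier coefficients is zero. -/
lemma ae_eq_zero_of_fc_eq_zero {f : ℝ → ℂ} (hf : MemLp f 2 circMeasure) (h : ∀ k, fc f k = 0) :
    f =ᵐ[circMeasure] 0 := by
  have h1 := tsum_enorm_sq_fc hf
  simp only [h, enorm_zero, ne_eq, OfNat.ofNat_ne_zero, not_false_eq_true, zero_pow,
    tsum_zero] at h1
  have h2 := (mul_eq_zero.1 h1.symm).resolve_left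
    (by rw [ENNReal.ofReal_eq_zero, not_le]; positivity)
  rw [lintegral_eq_zero_iff' (hf.1.enorm.pow_const 2)] at h2
  filter_upwards [h2] with x hx
  simpa using hx

lemma lintegral_circ_add {F : ℝ → ℝ≥0∞} (hF : Function.Periodic F (2 * π)) (a : ℝ) :
    ∫⁻ x in circ, F (x + a) = ∫⁻ x in circ, F x := by
  have h1 : ∫⁻ x in circ, F (x + a) = ∫⁻ x in Set.Ioc (-π + a) (π + a), F x := by
    have := (measurePreserving_add_right volume a).setLIntegral_comp_preimage_emb
      (measurableEmbedding_addRight a) F (Set.Ioc (-π + a) (π + a))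
    rw [← this, circ]
    congr 2
    ext x; simp
  rw [h1]
  have h2 := (isAddFundamentalDomain_Ioc two_pi_pos (-π + a)).setLIntegral_eq
    (isAddFundamentalDomain_Ioc two_pi_pos (-π)) F ?_
  · rwa [show -π + a + 2 * π = π + a by ring, show -π + 2 * π = π by ring] at h2
  · rintro ⟨g, hg⟩ x
    obtain ⟨m, rfl⟩ := AddSubgroup.mem_zmultiples_iff.1 hg
    change F (m • (2 * π) + x) = F x
    rw [add_comm]
    exact hF.zsmul m x

lemma integral_circ_add {F : Type*} [NormedAddCommGroup F] [NormedSpace ℝ F] {f : ℝ → F}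
    (hf : Function.Periodic f (2 * π)) (a : ℝ) :
    ∫ x in circ, f (x + a) = ∫ x in circ, f x := by
  rw [circ, ← intervalIntegral.integral_of_le (by linarith [pi_pos]),
    ← intervalIntegral.integral_of_le (by linarith [pi_pos]),
    intervalIntegral.integral_comp_add_right]
  have := hf.intervalIntegral_add_eq (-π + a) (-π)
  convert this using 2 <;> ring

lemma fc_shift {f : ℝ → ℂ} (hf : Function.Periodic f (2 * π)) (h : ℝ) (k : ℤ) :
    fc (fun x => f (x + h)) k = Complex.exp (Complex.I * k * h) * fc f k := by
  have hp : Function.Periodic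
      (fun x : ℝ => f x * Complex.exp (-(Complex.I * (k : ℂ) * (x : ℂ)))) (2 * π) := by
    intro x
    simp only [hf x]
    congr 1
    rw [Complex.exp_eq_exp_iff_exists_int]
    exact ⟨-k, by push_cast; ring⟩
  simp only [fc]
  rw [← integral_circ_add hp h, mul_left_comm, ← integral_const_mul (Complex.exp _)]
  congr 1
  refine integral_congr_ae (ae_of_all _ fun x => ?_)
  simp only
  rw [mul_left_comm, ← Complex.exp_add]
  congr 2
  push_cast
  ring

lemma norm_exp_sub_one_sq (k : ℤ) (h : ℝ) :
    ‖Complex.exp (Complex.I * k * h) - 1‖ ^ 2 = 4 * sin (k * h / 2) ^ 2 := by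
  have h1 : Complex.I * (k : ℂ) * (h : ℂ) = ((k * h : ℝ) : ℂ) * Complex.I := by push_cast; ring
  have h2 := cos_sq (k * h / 2)
  rw [show 2 * (k * h / 2) = k * h by ring] at h2
  rw [h1, Complex.sq_norm, Complex.normSq_apply, Complex.sub_re, Complex.sub_im,
    Complex.exp_ofReal_mul_I_re, Complex.exp_ofReal_mul_I_im, Complex.one_re, Complex.one_im]
  linear_combination sin_sq_add_cos_sq (k * h) - 4 * sin_sq_add_cos_sq (k * h / 2) + 4 * h2

lemma sin_half_ne_zero {h : ℝ} (hh : h ∈ circ) (h0 : h ≠ 0) : sin (h / 2) ≠ 0 := by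
  obtain ⟨h1, h2⟩ := hh
  rcases lt_or_gt_of_ne h0 with hlt | hgt
  · exact (sin_neg_of_neg_of_neg_pi_lt (by linarith) (by linarith [pi_pos])).ne
  · exact (sin_pos_of_pos_of_lt_pi (by linarith) (by linarith [pi_pos])).ne'

lemma ae_circ_ne_zero : ∀ᵐ h ∂circMeasure, h ∈ circ ∧ h ≠ 0 :=
  (ae_restrict_mem measurableSet_circ).and (Measure.ae_ne _ 0)

lemma integral_cos_circ {m : ℕ} (hm : m ≠ 0) : ∫ h in circ, cos (m * h) = 0 := by
  have hm' : (m : ℝ) ≠ 0 := by exact_mod_cast hm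
  rw [circ, ← intervalIntegral.integral_of_le (by linarith [pi_pos]),
    intervalIntegral.integral_comp_mul_left _ hm', integral_cos]
  simp [mul_neg, sin_neg, sin_nat_mul_pi]

lemma volume_real_circ : ∫ _ in circ, (1 : ℝ) = 2 * π := by
  rw [circ, integral_const, measureReal_restrict_apply_univ, Real.volume_real_Ioc_of_le (by linarith [pi_pos])]
  simp; ring

/-- The Fejér kernel of order `k` is integrable on the circle with integral `2πk`. -/
lemma integral_fejer (k : ℕ) :
    Integrable (fun h : ℝ => sin (k * h / 2) ^ 2 / sin (h / 2) ^ 2) circMeasure ∧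
      ∫ h in circ, sin (k * h / 2) ^ 2 / sin (h / 2) ^ 2 = 2 * π * k := by
  induction k using Nat.strong_induction_on with
  | _ k ih =>
  match k, ih with
  | 0, _ => simp
  | 1, _ =>
    have : (fun h : ℝ => sin (((1 : ℕ) : ℝ) * h / 2) ^ 2 / sin (h / 2) ^ 2)
        =ᵐ[circMeasure] fun _ => 1 := by
      filter_upwards [ae_circ_ne_zero] with h hh
      have := sin_half_ne_zero hh.1 hh.2
      simp [this]
    refine ⟨(integrable_const 1).congr this.symm, ?_⟩
    rw [integral_congr_ae this, volume_real_circ]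
    simp
  | k + 2, ih =>
    obtain ⟨i1, e1⟩ := ih (k + 1) (by omega)
    obtain ⟨i0, e0⟩ := ih k (by omega)
    have hc : Integrable (fun h : ℝ => cos (((k + 1 : ℕ) : ℝ) * h)) circMeasure :=
      (by fun_prop : Continuous fun h : ℝ => cos (((k + 1 : ℕ) : ℝ) * h)).integrableOn_Ioc
    have : (fun h : ℝ => sin (((k + 2 : ℕ) : ℝ) * h / 2) ^ 2 / sin (h / 2) ^ 2)
        =ᵐ[circMeasure] fun h => (2 * (sin (((k + 1 : ℕ) : ℝ) * h / 2) ^ 2 / sin (h / 2) ^ 2)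
          - sin ((k : ℝ) * h / 2) ^ 2 / sin (h / 2) ^ 2) + 2 * cos (((k + 1 : ℕ) : ℝ) * h) := by
      filter_upwards [ae_circ_ne_zero] with h hh
      have := sin_half_ne_zero hh.1 hh.2
      have key : sin (((k + 2 : ℕ) : ℝ) * h / 2) ^ 2 = 2 * sin (((k + 1 : ℕ) : ℝ) * h / 2) ^ 2
          - sin ((k : ℝ) * h / 2) ^ 2 + 2 * cos (((k + 1 : ℕ) : ℝ) * h) * sin (h / 2) ^ 2 := by
        rw [show ((k + 2 : ℕ) : ℝ) * h / 2 = (k + 1 : ℕ) * h / 2 + h / 2 by push_cast; ring,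
          show (k : ℝ) * h / 2 = (k + 1 : ℕ) * h / 2 - h / 2 by push_cast; ring,
          show cos (((k + 1 : ℕ) : ℝ) * h) = cos (2 * ((k + 1 : ℕ) * h / 2)) by congr 1; ring,
          sin_add, sin_sub, cos_two_mul]
        generalize ((k + 1 : ℕ) : ℝ) * h / 2 = a
        linear_combination 2 * sin a ^ 2 * sin_sq_add_cos_sq (h / 2)
          - 2 * sin (h / 2) ^ 2 * sin_sq_add_cos_sq a
      rw [key]
      field_simp
    refine ⟨(((i1.const_mul 2).sub i0).add (hc.const_mul 2)).congr this.symm, ?_⟩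
    have i2 : Integrable (fun h : ℝ => 2 * (sin (((k + 1 : ℕ) : ℝ) * h / 2) ^ 2 / sin (h / 2) ^ 2)
          - sin ((k : ℝ) * h / 2) ^ 2 / sin (h / 2) ^ 2) circMeasure := (i1.const_mul 2).sub i0
    rw [integral_congr_ae this, integral_add i2 (hc.const_mul 2), integral_sub (i1.const_mul 2) i0, integral_const_mul, integral_const_mul, e1, e0,
      integral_cos_circ (by omega)]
    push_cast
    ring

lemma lintegral_multiplier (k : ℤ) :
    ∫⁻ h in circ, ENNReal.ofReal (‖Complex.exp (Complex.I * k * h) - 1‖ ^ 2 / (4 * sin (h / 2) ^ 2))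
      = ENNReal.ofReal (2 * π) * k.natAbs := by
  obtain ⟨hi, he⟩ := integral_fejer k.natAbs
  have : ∀ h : ℝ, ‖Complex.exp (Complex.I * k * h) - 1‖ ^ 2 / (4 * sin (h / 2) ^ 2)
      = sin (k.natAbs * h / 2) ^ 2 / sin (h / 2) ^ 2 := by
    intro h
    rw [norm_exp_sub_one_sq, mul_div_mul_left _ _ (by norm_num)]
    congr 1
    rw [Nat.cast_natAbs, Int.cast_abs]
    rcases abs_choice (k : ℝ) with h1 | h1 <;> rw [h1]
    rw [neg_mul, neg_div, sin_neg, neg_sq]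
  simp only [this]
  rw [← ofReal_integral_eq_lintegral_ofReal hi (ae_of_all _ fun _ => by positivity), he,
    ENNReal.ofReal_mul (by positivity), ENNReal.ofReal_natCast]

lemma cd_add_right (x h : ℝ) : cd x (h + x) ^ 2 = 4 * sin (h / 2) ^ 2 := by
  rw [cd, mul_pow, sq_abs, show (x - (h + x)) / 2 = -(h / 2) by ring, sin_neg, neg_sq]
  norm_num

lemma cd_sq_periodic (x : ℝ) : Function.Periodic (fun y => cd x y ^ 2) (2 * π) := by
  intro y
  simp only [cd, mul_pow, sq_abs]
  rw [show (x - (y + 2 * π)) / 2 = (x - y) / 2 - π by ring, sin_sub_pi, neg_sq]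

/-- The energy density `∫ |f(x)-f(y)|²/|x-y|² dy` with values in `[0,∞]`. -/
def energyDensity (f : ℝ → ℂ) (x : ℝ) : ℝ≥0∞ :=
  ∫⁻ y in circ, ENNReal.ofReal (‖f x - f y‖ ^ 2 / cd x y ^ 2)

lemma energyDensity_eq_shift {f : ℝ → ℂ} (hp : Function.Periodic f (2 * π)) (x : ℝ) :
    energyDensity f x =
      ∫⁻ h in circ, ENNReal.ofReal (‖f (x + h) - f x‖ ^ 2 / (4 * sin (h / 2) ^ 2)) := by
  have hP : Function.Periodic (fun y => ENNReal.ofReal (‖f x - f y‖ ^ 2 / cd x y ^ 2)) (2 * π) := by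
    intro y
    simp only [hp y]
    rw [show cd x (y + 2 * π) ^ 2 = cd x y ^ 2 from cd_sq_periodic x y]
  rw [energyDensity, ← lintegral_circ_add hP x]
  simp only [cd_add_right, norm_sub_rev, add_comm x]
  
lemma lintegral_sq_shift_sub {f : ℝ → ℂ} (hp : Function.Periodic f (2 * π)) (hf : Measurable f)
    (hf2 : MemLp f 2 circMeasure) (h : ℝ) :
    ∫⁻ x in circ, ‖f (x + h) - f x‖ₑ ^ 2 =
      ENNReal.ofReal (2 * π) *
        ∑' k : ℤ, ENNReal.ofReal (‖Complex.exp (Complex.I * k * h) - 1‖ ^ 2) * ‖fc f k‖ₑ ^ 2 := by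
  have hs : MemLp (fun x => f (x + h)) 2 circMeasure := by
    refine ⟨(hf.comp (measurable_add_const h)).aestronglyMeasurable, ?_⟩
    have h1 := hf2.2
    rw [eLpNorm_lt_top_iff_lintegral_rpow_enorm_lt_top (by norm_num) (by norm_num)] at h1 ⊢
    rwa [lintegral_circ_add (F := fun x => ‖f x‖ₑ ^ (ENNReal.toReal 2))
      (fun x => by simp only [hp x])]
  have hd := tsum_enorm_sq_fc (hs.sub hf2)
  have hfc : ∀ k, ‖fc ((fun x => f (x + h)) - f) k‖ₑ ^ 2
      = ENNReal.ofReal (‖Complex.exp (Complex.I * k * h) - 1‖ ^ 2) * ‖fc f k‖ₑ ^ 2 := by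
    intro k
    rw [show (fun x => f (x + h)) - f = fun x => f (x + h) - f x from rfl,
      fc_sub (hs.integrable one_le_two) (hf2.integrable one_le_two), fc_shift hp,
      ← enorm_sq_eq_ofReal, ← mul_pow, ← enorm_mul]
    congr 2
    ring
  simp only [hfc] at hd
  rw [hd, ← mul_assoc, ← ENNReal.ofReal_mul (by positivity), mul_inv_cancel₀ (by positivity),
    ENNReal.ofReal_one, one_mul]
  rfl

/-- The Gagliardo energy on the circle in terms of Fourier coefficients. -/
theorem lintegral_energyDensity {f : ℝ → ℂ} (hp : Function.Periodic f (2 * π)) (hf : Measurable f)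
    (hf2 : MemLp f 2 circMeasure) :
    ∫⁻ x in circ, energyDensity f x =
      ENNReal.ofReal (4 * π ^ 2) * ∑' k : ℤ, (k.natAbs : ℝ≥0∞) * ‖fc f k‖ₑ ^ 2 := by
  simp only [energyDensity_eq_shift hp]
  rw [lintegral_lintegral_swap (by fun_prop)]
  have h1 : ∀ h : ℝ, ∫⁻ x in circ, ENNReal.ofReal (‖f (x + h) - f x‖ ^ 2 / (4 * sin (h / 2) ^ 2))
      = ∑' k : ℤ, ENNReal.ofReal (2 * π) * ‖fc f k‖ₑ ^ 2 *
        ENNReal.ofReal (‖Complex.exp (Complex.I * k * h) - 1‖ ^ 2 / (4 * sin (h / 2) ^ 2)) := by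
    intro h
    simp only [div_eq_mul_inv, ENNReal.ofReal_mul (sq_nonneg _), ← enorm_sq_eq_ofReal]
    rw [lintegral_mul_const _ (by fun_prop), lintegral_sq_shift_sub hp hf hf2,
      ← ENNReal.tsum_mul_left, ← ENNReal.tsum_mul_right]
    refine tsum_congr fun k => ?_
    rw [← enorm_sq_eq_ofReal]
    ring
  simp only [h1]
  rw [lintegral_tsum (fun k => by fun_prop), ← ENNReal.tsum_mul_left]
  refine tsum_congr fun k => ?_
  rw [lintegral_const_mul _ (by fun_prop), lintegral_multiplier,
    show 4 * π ^ 2 = (2 * π) * (2 * π) by ring, ENNReal.ofReal_mul two_pi_pos.le]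
  generalize ENNReal.ofReal (2 * π) = a
  ring

/-- Hardy's inequality on the circle for continuously differentiable functions. -/
lemma hardy_of_hasDerivAt {f f' : ℝ → ℝ} (hd : ∀ x, HasDerivAt f (f' x) x) (hc : Continuous f')
    (h0 : f 0 = 0) :
    Integrable (fun h => f h ^ 2 / (4 * sin (h / 2) ^ 2)) circMeasure ∧
      ∫ h in circ, f h ^ 2 / (4 * sin (h / 2) ^ 2) ≤ 4 * ∫ h in circ, f' h ^ 2 := by
  have hfc : Continuous f := continuous_iff_continuousAt.2 fun x => (hd x).continuousAt
  obtain ⟨K, hK⟩ := (isCompact_Icc (a := -π) (b := π)).exists_bound_of_continuousOn hc.continuousOn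
  have hpi := pi_pos
  have hK0 : 0 ≤ K := (norm_nonneg _).trans (hK 0 ⟨by linarith, by linarith⟩)
  have hfK : ∀ h ∈ Set.Icc (-π) π, |f h| ≤ K * |h| := by
    intro h hh
    have := (convex_Icc (-π) π).norm_image_sub_le_of_norm_hasDerivWithin_le
      (fun x _ => (hd x).hasDerivWithinAt) hK ⟨by linarith, by linarith⟩ hh (x := 0)
    simpa [h0] using this
  set q : ℝ → ℝ := fun h => f h / sin (h / 2) with hq
  have hqm : Measurable q := hfc.measurable.div (by fun_prop)
  have hqK : ∀ h ∈ Set.Icc (-π) π, |q h| ≤ K * π := by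
    intro h hh
    rcases eq_or_ne h 0 with rfl | hne
    · simp [hq, h0]; positivity
    have h1 := mul_abs_le_abs_sin (x := h / 2)
      (by rw [abs_div, abs_two]; have := abs_le.2 hh; gcongr)
    have hpos : 0 < |h| := abs_pos.2 hne
    have h2 : |h| / π ≤ |sin (h / 2)| := by
      rw [abs_div, abs_two] at h1
      convert h1 using 1; field_simp
    rw [hq]
    simp only
    rw [abs_div, div_le_iff₀ (lt_of_lt_of_le (by positivity) h2)]
    calc |f h| ≤ K * |h| := hfK h hh
      _ = K * π * (|h| / π) := by field_simp
      _ ≤ _ := by gcongr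
  have hmem : ∀ᵐ h ∂circMeasure, h ∈ Set.Icc (-π) π :=
    (ae_restrict_mem measurableSet_circ).mono fun h hh => Set.Ioc_subset_Icc_self hh
  have hA : ∀ h, f h ^ 2 / (4 * sin (h / 2) ^ 2) = q h ^ 2 / 4 := by
    intro h; simp only [hq, div_pow]; rw [div_div, mul_comm]
  have iq : Integrable (fun h => q h ^ 2 / 4) circMeasure := by
    refine Integrable.of_bound ((hqm.pow_const 2).div_const 4).aestronglyMeasurable
      ((K * π) ^ 2 / 4) ?_
    filter_upwards [hmem] with h hh
    rw [norm_of_nonneg (by positivity), ← sq_abs]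
    have := hqK h hh
    gcongr
  have iB : Integrable (fun h => cos (h / 2) * q h * f' h) circMeasure := by
    refine Integrable.of_bound (by fun_prop) (1 * (K * π) * K) ?_
    filter_upwards [hmem] with h hh
    rw [norm_mul, norm_mul]
    have h1 := hqK h hh
    have h2 := hK h hh
    have h3 := abs_cos_le_one (h / 2)
    rw [norm_eq_abs, norm_eq_abs]
    gcongr
  have if' : Integrable (fun h => f' h ^ 2) circMeasure := (hc.pow 2).integrableOn_Ioc
  simp only [hA]
  refine ⟨iq, ?_⟩
  set G : ℝ → ℝ := fun h => -(1 / 2) * (cos (h / 2) * q h * f h) with hG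
  have hG0 : G 0 = 0 := by simp [hG, h0]
  have hsin : ∀ h ∈ Set.Icc (-π) π, h ≠ 0 → sin (h / 2) ≠ 0 := by
    intro h hh hne
    rcases eq_or_lt_of_le hh.1 with h1 | h1
    · rw [← h1, neg_div, sin_neg, sin_pi_div_two]; norm_num
    · exact sin_half_ne_zero ⟨h1, hh.2⟩ hne
  have key := integral_eq_of_hasDerivAt_off_countable_of_le G
    (fun h => q h ^ 2 / 4 - cos (h / 2) * q h * f' h) (a := -π) (b := π) (by linarith)
    (Set.countable_singleton 0) ?_ ?_ ?_
  · have hG1 : G π = 0 := by simp [hG]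
    have hG2 : G (-π) = 0 := by simp [hG, neg_div]
    rw [hG1, hG2, sub_zero, intervalIntegral.integral_of_le (by linarith)] at key
    change ∫ h in circ, (q h ^ 2 / 4 - cos (h / 2) * q h * f' h) = 0 at key
    rw [integral_sub iq iB] at key
    have hle : ∫ h in circ, cos (h / 2) * q h * f' h ≤
        ∫ h in circ, (1 / 2 * (q h ^ 2 / 4) + 2 * f' h ^ 2) := by
      refine integral_mono iB ((iq.const_mul _).add (if'.const_mul 2)) fun h => ?_
      simp only
      have h3 := cos_sq_le_one (h / 2)
      nlinarith [sq_nonneg (q h - 4 * (cos (h / 2) * f' h)), mul_nonneg (sq_nonneg (f' h))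
        (sub_nonneg.2 h3)]
    rw [integral_add (iq.const_mul _) (if'.const_mul 2), integral_const_mul,
      integral_const_mul] at hle
    linarith
  · intro h hh
    rcases eq_or_ne h 0 with rfl | hne
    · refine ContinuousAt.continuousWithinAt ?_
      rw [ContinuousAt, hG0]
      refine squeeze_zero_norm' (a := fun h => 1 / 2 * (1 * (K * π) * |f h|)) ?_ ?_
      · filter_upwards [Icc_mem_nhds (show -π < 0 by linarith) hpi] with h hh
        simp only [hG]
        rw [norm_mul, norm_mul, norm_mul, norm_neg, norm_eq_abs, norm_eq_abs, norm_eq_abs,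
          norm_eq_abs, abs_of_pos (by norm_num : (0 : ℝ) < 1 / 2)]
        have h1 := hqK h hh
        have h3 := abs_cos_le_one (h / 2)
        gcongr
      · have : Continuous fun h => 1 / 2 * (1 * (K * π) * |f h|) := by fun_prop
        simpa [h0] using this.tendsto 0
    · refine ContinuousAt.continuousWithinAt ?_
      have := hsin h hh hne
      simp only [hG, hq]
      fun_prop (disch := assumption)
  · rintro h ⟨hh, hne⟩
    have hs := hsin h (Set.Ioo_subset_Icc_self hh) hne
    have d1 : HasDerivAt (fun h : ℝ => sin (h / 2)) (cos (h / 2) * (1 / 2)) h :=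
      ((hasDerivAt_id h).div_const 2).sin
    have d2 : HasDerivAt (fun h : ℝ => cos (h / 2)) (-sin (h / 2) * (1 / 2)) h :=
      ((hasDerivAt_id h).div_const 2).cos
    have d3 := ((d2.mul ((hd h).div d1 hs)).mul (hd h)).const_mul (-(1 / 2))
    convert! d3 using 1
    simp only [hq, Pi.mul_apply, Pi.div_apply]
    have hsc := sin_sq_add_cos_sq (h / 2)
    field_simp
    linear_combination (-4 * f h ^ 2) * hsc
  · rw [intervalIntegrable_iff_integrableOn_Ioc_of_le (by linarith)]
    exact iq.sub iB

lemma hardy_complex {f f' : ℝ → ℂ} (hd : ∀ x, HasDerivAt f (f' x) x) (hc : Continuous f')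
    (h0 : f 0 = 0) :
    ∫⁻ h in circ, ENNReal.ofReal (‖f h‖ ^ 2 / (4 * sin (h / 2) ^ 2)) ≤
      ENNReal.ofReal (4 * ∫ h in circ, ‖f' h‖ ^ 2) := by
  obtain ⟨i1, e1⟩ := hardy_of_hasDerivAt (f := fun x => (f x).re) (f' := fun x => (f' x).re)
    (fun x => Complex.reCLM.hasFDerivAt.comp_hasDerivAt x (hd x)) (by fun_prop) (by simp [h0])
  obtain ⟨i2, e2⟩ := hardy_of_hasDerivAt (f := fun x => (f x).im) (f' := fun x => (f' x).im)
    (fun x => Complex.imCLM.hasFDerivAt.comp_hasDerivAt x (hd x)) (by fun_prop) (by simp [h0])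
  have hs : ∀ z : ℂ, ‖z‖ ^ 2 = z.re ^ 2 + z.im ^ 2 := fun z => by
    rw [Complex.sq_norm, Complex.normSq_apply]; ring
  simp only [hs, add_div]
  have i12 : Integrable (fun h => (f h).re ^ 2 / (4 * sin (h / 2) ^ 2) +
      (f h).im ^ 2 / (4 * sin (h / 2) ^ 2)) circMeasure := i1.add i2
  rw [← ofReal_integral_eq_lintegral_ofReal i12 (ae_of_all _ fun _ => by positivity)]
  refine ENNReal.ofReal_le_ofReal ?_
  rw [integral_add i1 i2, integral_add (by exact (by fun_prop : Continuous _).integrableOn_Ioc)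
    (by exact (by fun_prop : Continuous _).integrableOn_Ioc)]
  linarith

lemma fc_exp (m k : ℤ) :
    fc (fun x => Complex.exp (Complex.I * m * x)) k = if k = m then 1 else 0 := by
  have h1 : ∀ x : ℝ, Complex.exp (Complex.I * m * x) *
      Complex.exp (-(Complex.I * (k : ℂ) * (x : ℂ))) = Complex.exp ((Complex.I * ((m - k : ℤ) : ℂ)) * x) := by
    intro x
    rw [← Complex.exp_add]
    congr 1
    push_cast
    ring
  simp only [fc, h1]
  split_ifs with h
  · subst h
    have : ∫ x in circ, (1 : ℂ) = ((2 * π : ℝ) : ℂ) := by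
      rw [← volume_real_circ, ← integral_complex_ofReal]; simp
    simp only [sub_self, Int.cast_zero, mul_zero, zero_mul, Complex.exp_zero, this]
    rw [← Complex.ofReal_mul, one_div, inv_mul_cancel₀ (by positivity), Complex.ofReal_one]
  · have hne : Complex.I * ((m - k : ℤ) : ℂ) ≠ 0 :=
      mul_ne_zero Complex.I_ne_zero (by exact_mod_cast sub_ne_zero.2 (Ne.symm h))
    rw [circ, ← intervalIntegral.integral_of_le (by linarith [pi_pos]),
      integral_exp_mul_complex hne]
    have : Complex.exp (Complex.I * ((m - k : ℤ) : ℂ) * (π : ℝ))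
        = Complex.exp (Complex.I * ((m - k : ℤ) : ℂ) * (-π : ℝ)) := by
      rw [Complex.exp_eq_exp_iff_exists_int]
      exact ⟨m - k, by push_cast; ring⟩
    rw [this]; simp

lemma fc_finset_sum (s : Finset ℤ) (a : ℤ → ℂ) (k : ℤ) :
    fc (fun x => ∑ m ∈ s, a m * Complex.exp (Complex.I * m * x)) k = if k ∈ s then a k else 0 := by
  have h1 : fc (fun x => ∑ m ∈ s, a m * Complex.exp (Complex.I * m * x)) k
      = ∑ m ∈ s, fc (fun x => a m * Complex.exp (Complex.I * m * x)) k := by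
    simp only [fc, Finset.sum_mul]
    rw [integral_finsetSum _ fun m _ => ?_, Finset.mul_sum]
    exact (by fun_prop : Continuous fun x : ℝ => a m * Complex.exp (Complex.I * m * x) *
      Complex.exp (-(Complex.I * (k : ℂ) * (x : ℂ)))).integrableOn_Ioc
  rw [h1]
  simp only [fc_const_mul, fc_exp, mul_ite, mul_one, mul_zero]
  simp

lemma memLp_of_continuous {f : ℝ → ℂ} (hf : Continuous f) : MemLp f 2 circMeasure := by
  obtain ⟨K, hK⟩ := (isCompact_Icc (a := -π) (b := π)).exists_bound_of_continuousOn hf.continuousOn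
  exact MemLp.of_bound hf.aestronglyMeasurable K
    ((ae_restrict_mem measurableSet_circ).mono fun h hh => hK h (Set.Ioc_subset_Icc_self hh))

lemma integral_norm_sq_finset_sum (s : Finset ℤ) (a : ℤ → ℂ) :
    ∫ x in circ, ‖∑ m ∈ s, a m * Complex.exp (Complex.I * m * x)‖ ^ 2
      = 2 * π * ∑ m ∈ s, ‖a m‖ ^ 2 := by
  have h := hasSum_sq_fc (memLp_of_continuous
    (by fun_prop : Continuous fun x : ℝ => ∑ m ∈ s, a m * Complex.exp (Complex.I * m * x)))
  simp only [fc_finset_sum] at h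
  have h2 : HasSum (fun k => ‖if k ∈ s then a k else 0‖ ^ 2) (∑ m ∈ s, ‖a m‖ ^ 2) := by
    have h3 : HasSum (fun k : ℤ => ‖if k ∈ s then a k else 0‖ ^ 2)
        (∑ m ∈ s, ‖if m ∈ s then a m else 0‖ ^ 2) :=
      hasSum_sum_of_ne_finset_zero fun b hb => by simp [hb]
    rwa [Finset.sum_congr rfl fun m hm => by rw [if_pos hm]] at h3
  rw [h2.unique h, ← mul_assoc, mul_inv_cancel₀ (by positivity), one_mul]

lemma summable_norm_of_summable_sq {c : ℤ → ℂ} (hc : Summable fun k : ℤ => (k : ℝ) ^ 2 * ‖c k‖ ^ 2) :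
    Summable fun k => ‖c k‖ := by
  have h1 : Summable fun k : ℤ => 1 / (k : ℝ) ^ 2 := Real.summable_one_div_int_pow.2 one_lt_two
  have h2 : Summable fun k : ℤ => if k = 0 then ‖c 0‖ else 0 := by
    exact (hasSum_ite_eq 0 _).summable
  refine Summable.of_nonneg_of_le (fun _ => norm_nonneg _) (fun k => ?_) ((hc.add h1).add h2)
  split_ifs with hk
  · subst hk; simp
  · have hk' : (0 : ℝ) < (k : ℝ) ^ 2 := by positivity
    have hk1 : |(k : ℝ)| ≠ 0 := by positivity
    have h3 : |(k : ℝ)| ^ 2 = (k : ℝ) ^ 2 := sq_abs _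
    rw [add_zero, ← h3, ← mul_pow, ← one_div_pow]
    have h4 : (|(k : ℝ)| * ‖c k‖) * (1 / |(k : ℝ)|) = ‖c k‖ := by field_simp
    generalize |(k : ℝ)| * ‖c k‖ = A at *
    generalize 1 / |(k : ℝ)| = B at *
    rw [← h4]
    nlinarith [sq_nonneg (A - B), sq_nonneg (A + B)]

lemma energyDensity_tsum_le {c : ℤ → ℂ} (hc : Summable fun k : ℤ => (k : ℝ) ^ 2 * ‖c k‖ ^ 2)
    (x : ℝ) :
    energyDensity (fun x => ∑' k, c k * Complex.exp (Complex.I * k * x)) x ≤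
      ENNReal.ofReal (8 * π * ∑' k : ℤ, (k : ℝ) ^ 2 * ‖c k‖ ^ 2) := by
  have hper : ∀ k : ℤ, ∀ x : ℝ, Complex.exp (Complex.I * k * ((x + 2 * π : ℝ) : ℂ))
      = Complex.exp (Complex.I * k * x) := by
    intro k x
    rw [Complex.exp_eq_exp_iff_exists_int]
    exact ⟨k, by push_cast; ring⟩
  have hsum : ∀ x : ℝ, Summable fun k => c k * Complex.exp (Complex.I * k * x) := fun x =>
    Summable.of_norm (by simpa [norm_exp_I_mul] using summable_norm_of_summable_sq hc)
  rw [energyDensity_eq_shift (fun x => by simp only [hper])]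
  set P : Finset ℤ → ℝ → ℂ := fun s h =>
    (∑ k ∈ s, c k * Complex.exp (Complex.I * k * x) * Complex.exp (Complex.I * k * h))
      - ∑ k ∈ s, c k * Complex.exp (Complex.I * k * x) with hP
  have hlim : ∀ h : ℝ, Tendsto (fun s => P s h) atTop
      (𝓝 ((∑' k, c k * Complex.exp (Complex.I * k * ((x + h : ℝ) : ℂ)))
        - ∑' k, c k * Complex.exp (Complex.I * k * x))) := by
    intro h
    refine Tendsto.sub ?_ (hsum x).hasSum
    have h1 : Tendsto (fun s : Finset ℤ => ∑ k ∈ s, c k * Complex.exp (Complex.I * k * ((x + h : ℝ) : ℂ)))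
      atTop (𝓝 (∑' k, c k * Complex.exp (Complex.I * k * ((x + h : ℝ) : ℂ)))) := (hsum (x + h)).hasSum
    refine h1.congr fun s => Finset.sum_congr rfl fun k _ => ?_
    rw [mul_assoc (c k), ← Complex.exp_add]
    congr 2
    push_cast
    ring
  have hP1 : ∀ s, ∫⁻ h in circ, ENNReal.ofReal (‖P s h‖ ^ 2 / (4 * sin (h / 2) ^ 2)) ≤
      ENNReal.ofReal (8 * π * ∑' k : ℤ, (k : ℝ) ^ 2 * ‖c k‖ ^ 2) := by
    intro s
    refine (hardy_complex (f' := fun h => ∑ k ∈ s, (c k * Complex.exp (Complex.I * k * x) *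
      (Complex.I * k)) * Complex.exp (Complex.I * k * h)) (fun h => ?_) (by fun_prop)
      (by simp [hP])).trans (ENNReal.ofReal_le_ofReal ?_)
    · refine HasDerivAt.sub_const _ ?_
      refine HasDerivAt.fun_sum fun k _ => ?_
      have h1 : HasDerivAt (fun h : ℝ => Complex.I * k * (h : ℂ)) (Complex.I * k * 1) h :=
        (Complex.ofRealCLM.hasDerivAt (x := h)).const_mul _
      convert! h1.cexp.const_mul (c k * Complex.exp (Complex.I * k * x)) using 1
      ring
    · rw [integral_norm_sq_finset_sum]
      have : ∀ k : ℤ, ‖c k * Complex.exp (Complex.I * k * x) * (Complex.I * k)‖ ^ 2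
          = (k : ℝ) ^ 2 * ‖c k‖ ^ 2 := by
        intro k
        rw [norm_mul, norm_mul, norm_exp_I_mul, norm_mul, Complex.norm_I, Complex.norm_intCast,
          mul_one, one_mul, mul_pow, sq_abs, mul_comm]
      simp only [this]
      have := hc.sum_le_tsum s (fun k _ => by positivity)
      nlinarith [pi_pos]
  calc _ = ∫⁻ h in circ, liminf (fun s => ENNReal.ofReal (‖P s h‖ ^ 2 / (4 * sin (h / 2) ^ 2))) atTop := by
        refine lintegral_congr fun h => (Tendsto.liminf_eq ?_).symm
        exact ENNReal.tendsto_ofReal ((((hlim h).norm).pow 2).div_const _)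
    _ ≤ liminf (fun s => ∫⁻ h in circ, ENNReal.ofReal (‖P s h‖ ^ 2 / (4 * sin (h / 2) ^ 2))) atTop :=
        lintegral_liminf_le fun s => by fun_prop
    _ ≤ _ := liminf_le_of_le (by isBoundedDefault) fun b hb => by
        obtain ⟨s, hs⟩ := hb.exists
        exact hs.trans (hP1 s)

lemma ae_eq_tsum_fc {f : ℝ → ℂ} (hf2 : MemLp f 2 circMeasure)
    (hs : Summable fun k => ‖fc f k‖) :
    ∀ᵐ x ∂circMeasure, f x = ∑' k, fc f k * Complex.exp (Complex.I * k * x) := by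
  set U : ℝ → ℂ := fun x => ∑' k, fc f k * Complex.exp (Complex.I * k * x) with hU
  have hUc : Continuous U := continuous_tsum (fun k => by fun_prop) hs
    fun k x => by rw [norm_mul, norm_exp_I_mul, mul_one]
  have hUfc : ∀ m, fc U m = fc f m := by
    intro m
    have h1 := hasSum_integral_of_summable_integral_norm (μ := circMeasure)
      (F := fun k x => fc f k * Complex.exp (Complex.I * k * x) *
        Complex.exp (-(Complex.I * (m : ℂ) * (x : ℂ))))
      (fun k => (by fun_prop : Continuous _).integrableOn_Ioc) ?_
    · have h2 := h1.mul_left ((1 / (2 * π) : ℝ) : ℂ)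
      have h3 : ∀ k, ((1 / (2 * π) : ℝ) : ℂ) * ∫ x in circ, fc f k * Complex.exp (Complex.I * k * x) *
          Complex.exp (-(Complex.I * (m : ℂ) * (x : ℂ))) = if k = m then fc f m else 0 := by
        intro k
        have := fc_const_mul (fc f k) (fun x => Complex.exp (Complex.I * k * x)) m
        rw [fc_exp, fc] at this
        rw [this]
        by_cases h : k = m
        · subst h; simp
        · rw [if_neg (Ne.symm h), if_neg h, mul_zero]
      simp only [h3, tsum_mul_right] at h2
      exact h2.unique (hasSum_ite_eq m _)
    · simp only [norm_mul, norm_exp_I_mul, norm_exp_neg_I_mul, mul_one]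
      simpa using hs.mul_left _
  have hUm := memLp_of_continuous hUc
  have h0 := ae_eq_zero_of_fc_eq_zero (hf2.sub hUm) fun k => by
    rw [show f - U = fun x => f x - U x from rfl,
      fc_sub (hf2.integrable one_le_two) (hUm.integrable one_le_two), hUfc, sub_self]
  filter_upwards [h0] with x hx
  exact sub_eq_zero.1 hx

/-- The energy density of an `H¹` function is essentially bounded. -/
theorem energyDensity_le {f : ℝ → ℂ} (hf2 : MemLp f 2 circMeasure)
    (hc : Summable fun k : ℤ => (k : ℝ) ^ 2 * ‖fc f k‖ ^ 2) :
    ∀ᵐ x ∂circMeasure, energyDensity f x ≤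
      ENNReal.ofReal (8 * π * ∑' k : ℤ, (k : ℝ) ^ 2 * ‖fc f k‖ ^ 2) := by
  have h := ae_eq_tsum_fc hf2 (summable_norm_of_summable_sq hc)
  filter_upwards [h] with x hx
  refine le_trans (le_of_eq ?_) (energyDensity_tsum_le hc x)
  refine lintegral_congr_ae ?_
  filter_upwards [h] with y hy
  rw [hx, hy]

lemma measurable_energyDensity_kernel {α : Type*} [MeasurableSpace α] {f : α → ℝ → ℂ}
    (hf : Measurable (Function.uncurry f)) :
    Measurable fun p : α × ℝ => energyDensity (f p.1) p.2 := by
  unfold energyDensity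
  refine Measurable.lintegral_prod_right' (f := fun q : (α × ℝ) × ℝ =>
    ENNReal.ofReal (‖f q.1.1 q.1.2 - f q.1.1 q.2‖ ^ 2 / cd q.1.2 q.2 ^ 2)) ?_
  have h1 : Measurable fun q : (α × ℝ) × ℝ => f q.1.1 q.1.2 := hf.comp measurable_fst
  have h2 : Measurable fun q : (α × ℝ) × ℝ => f q.1.1 q.2 :=
    hf.comp (measurable_fst.fst.prodMk measurable_snd)
  have h3 : Measurable fun q : (α × ℝ) × ℝ => cd q.1.2 q.2 := by unfold cd; fun_prop
  fun_prop

lemma measurable_energyDensity {f : ℝ → ℂ} (hf : Measurable f) : Measurable (energyDensity f) := by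
  unfold energyDensity
  refine Measurable.lintegral_prod_right' (f := fun q : ℝ × ℝ =>
    ENNReal.ofReal (‖f q.1 - f q.2‖ ^ 2 / cd q.1 q.2 ^ 2)) ?_
  have h3 : Measurable fun q : ℝ × ℝ => cd q.1 q.2 := by unfold cd; fun_prop
  fun_prop

lemma lintegral_energyDensity_eq_ofReal {f : ℝ → ℂ} (hp : Function.Periodic f (2 * π))
    (hf : Measurable f) (hf2 : MemLp f 2 circMeasure)
    (hs : Summable fun k : ℤ => (k.natAbs : ℝ) * ‖fc f k‖ ^ 2) :
    ∫⁻ x in circ, energyDensity f x =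
      ENNReal.ofReal (4 * π ^ 2 * ∑' k : ℤ, (k.natAbs : ℝ) * ‖fc f k‖ ^ 2) := by
  rw [lintegral_energyDensity hp hf hf2, ENNReal.ofReal_mul (p := 4 * π ^ 2) (by positivity),
    ENNReal.ofReal_tsum_of_nonneg (fun _ => by positivity) hs]
  congr 2
  funext k
  rw [ENNReal.ofReal_mul (by positivity), enorm_sq_eq_ofReal, ENNReal.ofReal_natCast]

/-- Fourier description of the polarised energy against a single mode. -/
lemma integral_polarised_energy {f : ℝ → ℂ} (hp : Function.Periodic f (2 * π))
    (hf : Measurable f) (hf2 : MemLp f 2 circMeasure)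
    (hs : Summable fun k : ℤ => (k.natAbs : ℝ) * ‖fc f k‖ ^ 2) (z : ℂ) (m : ℤ) :
    ∫ x in circ, ∫ y in circ, ((f x - f y) * (starRingEnd ℂ) (z * Complex.exp (Complex.I * m * x)
      - z * Complex.exp (Complex.I * m * y))).re / cd x y ^ 2
      = 4 * π ^ 2 * (m.natAbs * (fc f m * (starRingEnd ℂ) z).re) := by
  set g : ℝ → ℂ := fun x => z * Complex.exp (Complex.I * m * x) with hg
  have hgc : Continuous g := by fun_prop
  have hgp : Function.Periodic g (2 * π) := by
    intro x
    simp only [hg]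
    congr 1
    rw [Complex.exp_eq_exp_iff_exists_int]
    exact ⟨m, by push_cast; ring⟩
  have hgfc : ∀ k, fc g k = if k = m then z else 0 := by
    intro k
    rw [hg, fc_const_mul, fc_exp]
    split_ifs <;> simp
  have hgL := memLp_of_continuous hgc
  have hS : ∀ w : ℂ, Summable fun k : ℤ => (k.natAbs : ℝ) * ‖fc f k + if k = m then w else 0‖ ^ 2 := by
    intro w
    refine (summable_congr_cofinite ?_).1 hs
    filter_upwards [(Set.finite_singleton m).compl_mem_cofinite] with k hk
    rw [if_neg (by simpa using hk), add_zero]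
  have hpp : Function.Periodic (fun x => f x + g x) (2 * π) := hp.add hgp
  have hpm : Function.Periodic (fun x => f x - g x) (2 * π) := hp.sub hgp
  have hfp : Measurable fun x => f x + g x := hf.add hgc.measurable
  have hfm : Measurable fun x => f x - g x := hf.sub hgc.measurable
  have hLp : MemLp (fun x => f x + g x) 2 circMeasure := hf2.add hgL
  have hLm : MemLp (fun x => f x - g x) 2 circMeasure := hf2.sub hgL
  have hEp : ∫⁻ x in circ, energyDensity (fun x => f x + g x) x = ENNReal.ofReal (4 * π ^ 2 *
      ∑' k : ℤ, (k.natAbs : ℝ) * ‖fc f k + if k = m then z else 0‖ ^ 2) := by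
    have hfc : ∀ k, fc (fun x => f x + g x) k = fc f k + if k = m then z else 0 := fun k => by
      rw [fc_add (hf2.integrable one_le_two) (hgL.integrable one_le_two), hgfc]
    rw [lintegral_energyDensity_eq_ofReal hpp hfp hLp
      (by simpa only [hfc] using hS z)]
    simp only [hfc]
  have hEm : ∫⁻ x in circ, energyDensity (fun x => f x - g x) x = ENNReal.ofReal (4 * π ^ 2 *
      ∑' k : ℤ, (k.natAbs : ℝ) * ‖fc f k + if k = m then -z else 0‖ ^ 2) := by
    have hfc : ∀ k, fc (fun x => f x - g x) k = fc f k + if k = m then -z else 0 := fun k => by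
      rw [fc_sub (hf2.integrable one_le_two) (hgL.integrable one_le_two), hgfc]
      split_ifs <;> simp [sub_eq_add_neg]
    rw [lintegral_energyDensity_eq_ofReal hpm hfm hLm
      (by simpa only [hfc] using hS (-z))]
    simp only [hfc]
  have hmp := measurable_energyDensity hfp
  have hmm := measurable_energyDensity hfm
  have hinner : ∀ᵐ x ∂circMeasure, ∫ y in circ, ((f x - f y) * (starRingEnd ℂ) (g x - g y)).re / cd x y ^ 2
      = 1 / 4 * ((energyDensity (fun x => f x + g x) x).toReal
        - (energyDensity (fun x => f x - g x) x).toReal) := by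
    filter_upwards [ae_lt_top hmp (by rw [hEp]; exact ENNReal.ofReal_ne_top),
      ae_lt_top hmm (by rw [hEm]; exact ENNReal.ofReal_ne_top)] with x hx1 hx2
    have hcd : Measurable fun y => cd x y := by unfold cd; fun_prop
    have hi1 : Integrable (fun y => ‖(f x + g x) - (f y + g y)‖ ^ 2 / cd x y ^ 2) circMeasure :=
      (lintegral_ofReal_ne_top_iff_integrable (Measurable.aestronglyMeasurable (by fun_prop)) (ae_of_all _ fun _ => by positivity)).1 hx1.ne
    have hi2 : Integrable (fun y => ‖(f x - g x) - (f y - g y)‖ ^ 2 / cd x y ^ 2) circMeasure :=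
      (lintegral_ofReal_ne_top_iff_integrable (Measurable.aestronglyMeasurable (by fun_prop)) (ae_of_all _ fun _ => by positivity)).1 hx2.ne
    rw [energyDensity, energyDensity, ← integral_eq_lintegral_of_nonneg_ae (ae_of_all _ fun _ => by positivity)
      hi1.aestronglyMeasurable, ← integral_eq_lintegral_of_nonneg_ae (ae_of_all _ fun _ => by positivity)
      hi2.aestronglyMeasurable, ← integral_sub hi1 hi2, ← integral_const_mul]
    refine integral_congr_ae (ae_of_all _ fun y => ?_)
    simp only
    rw [← sub_div, ← mul_div_assoc]
    congr 1
    simp only [Complex.sq_norm, Complex.normSq_apply, Complex.mul_re, Complex.sub_re, Complex.sub_im,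
      Complex.add_re, Complex.add_im, Complex.conj_re, Complex.conj_im]
    ring
  rw [integral_congr_ae hinner, integral_const_mul, integral_sub
    (integrable_toReal_of_lintegral_ne_top hmp.aemeasurable (by rw [hEp]; exact ENNReal.ofReal_ne_top))
    (integrable_toReal_of_lintegral_ne_top hmm.aemeasurable (by rw [hEm]; exact ENNReal.ofReal_ne_top)),
    integral_toReal hmp.aemeasurable (ae_lt_top hmp (by rw [hEp]; exact ENNReal.ofReal_ne_top)),
    integral_toReal hmm.aemeasurable (ae_lt_top hmm (by rw [hEm]; exact ENNReal.ofReal_ne_top)),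
    hEp, hEm, ENNReal.toReal_ofReal (mul_nonneg (by positivity) (tsum_nonneg fun _ => by positivity)),
    ENNReal.toReal_ofReal (mul_nonneg (by positivity) (tsum_nonneg fun _ => by positivity)),
    ← mul_sub, ← (hS z).tsum_sub (hS (-z)), tsum_eq_single m]
  · simp only [if_true, Complex.sq_norm, Complex.normSq_apply, Complex.mul_re,
      Complex.add_re, Complex.add_im, Complex.conj_re, Complex.conj_im, Complex.neg_re, Complex.neg_im]
    ring
  · intro k hk
    simp [hk]

/-- The real trigonometric mode `Re (z e^{imx})`. -/
def mode (z : ℂ) (m : ℤ) (x : ℝ) : ℝ := (z * Complex.exp (Complex.I * m * x)).re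

lemma mode_periodic (z : ℂ) (m : ℤ) : Function.Periodic (mode z m) (2 * π) := by
  intro x
  simp only [mode]
  congr 2
  rw [Complex.exp_eq_exp_iff_exists_int]
  exact ⟨m, by push_cast; ring⟩

lemma integral_mul_mode {f : ℝ → ℝ} (hf : Integrable f circMeasure) (z : ℂ) (m : ℤ) :
    ∫ x in circ, f x * mode z m x = 2 * π * (fcR f m * (starRingEnd ℂ) z).re := by
  have hi := integrable_mul_exp (f := fun x => (f x : ℂ)) hf.ofReal m
  have h1 : (fcR f m * (starRingEnd ℂ) z) = ((1 / (2 * π) : ℝ) : ℂ) *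
      ∫ x in circ, (starRingEnd ℂ) z * ((f x : ℂ) * Complex.exp (-(Complex.I * (m : ℂ) * (x : ℂ)))) := by
    rw [integral_const_mul, fcR, fc]; ring
  have h2 := integral_re (𝕜 := ℂ) (hi.const_mul ((starRingEnd ℂ) z))
  simp only [RCLike.re_to_complex] at h2
  rw [h1, Complex.re_ofReal_mul, ← h2, ← mul_assoc, mul_one_div_cancel (by positivity), one_mul]
  refine integral_congr_ae (ae_of_all _ fun x => ?_)
  have h3 : Complex.exp (-(Complex.I * (m : ℂ) * (x : ℂ)))
      = (starRingEnd ℂ) (Complex.exp (Complex.I * m * x)) := by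
    rw [← Complex.exp_conj]; simp
  simp only [mode, h3, Complex.mul_re, Complex.ofReal_re, Complex.ofReal_im, Complex.mul_im,
    Complex.conj_re, Complex.conj_im]
  ring

lemma sum_mul_single {n : ℕ} (a : E n) (i : Fin n) (c : ℝ) :
    ∑ j, a j * (EuclideanSpace.single i c : E n) j = a i * c := by
  simp [PiLp.single_apply]

lemma pairing_single_mode {n : ℕ} {u : ℝ → E n} (hp : Function.Periodic u (2 * π))
    (hf : Measurable u) (i : Fin n) (hf2 : MemLp (fun x => u x i) 2 circMeasure)
    (hs : Summable fun k : ℤ => (k.natAbs : ℝ) * ‖fcV u k i‖ ^ 2) (c : ℝ) (z : ℂ) (m : ℤ) :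
    pairing u (fun x => EuclideanSpace.single i (c * mode z m x))
      = c * (4 * π ^ 2 * (m.natAbs * (fcV u m i * (starRingEnd ℂ) z).re)) := by
  have hm : Measurable fun x => (u x i : ℂ) := by fun_prop
  rw [show fcV u m i = fc (fun x => (u x i : ℂ)) m from rfl,
    ← integral_polarised_energy (fun x => by simp only [hp x]) hm hf2.ofReal hs, pairing,
    ← integral_const_mul]
  refine integral_congr_ae (ae_of_all _ fun x => ?_)
  simp only
  rw [← integral_const_mul]
  refine integral_congr_ae (ae_of_all _ fun y => ?_)
  simp only
  have h1 : ∑ j, (u x j - u y j) * ((EuclideanSpace.single i (c * mode z m x) : E n) j -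
      (EuclideanSpace.single i (c * mode z m y) : E n) j)
        = (u x i - u y i) * (c * mode z m x - c * mode z m y) := by
    simp [PiLp.single_apply, mul_sub, Finset.sum_sub_distrib]
  rw [h1, ← mul_div_assoc, mode, mode]
  congr 1
  simp only [Complex.mul_re, Complex.ofReal_re, Complex.ofReal_im, Complex.sub_re, Complex.sub_im,
    Complex.conj_re, Complex.conj_im]
  ring

/-- `[0,∞]`-valued version of `gagl`. -/
def gaglE {n : ℕ} (u : ℝ → E n) (x : ℝ) : ℝ≥0∞ := ∑ i, energyDensity (fun x => (u x i : ℂ)) x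

lemma gagl_eq_toReal {n : ℕ} {u : ℝ → E n} (hu : Measurable u) (x : ℝ) :
    gagl u x = (gaglE u x).toReal := by
  have hcd : Measurable fun y => cd x y := by unfold cd; fun_prop
  have hm : ∀ i, Measurable fun y => (u y i : ℂ) := fun i => by fun_prop
  unfold gagl gaglE energyDensity
  rw [integral_eq_lintegral_of_nonneg_ae
    (ae_of_all _ fun _ => div_nonneg (Finset.sum_nonneg fun _ _ => sq_nonneg _) (sq_nonneg _))
    (Measurable.aestronglyMeasurable (by fun_prop)), ← lintegral_finsetSum _ fun i _ => by have := hm i; fun_prop]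
  congr 1
  refine lintegral_congr fun y => ?_
  rw [Finset.sum_div, ENNReal.ofReal_sum_of_nonneg fun i _ => by positivity]
  refine Finset.sum_congr rfl fun i _ => ?_
  rw [← Complex.ofReal_sub, Complex.norm_real, Real.norm_eq_abs, sq_abs]

lemma measurable_gaglE_kernel {n : ℕ} {u : ℝ → ℝ → E n} (hu : Measurable (Function.uncurry u)) :
    Measurable fun p : ℝ × ℝ => gaglE (u p.1) p.2 := by
  unfold gaglE
  refine Finset.measurable_sum _ fun i _ => ?_
  refine measurable_energyDensity_kernel (f := fun t x => (u t x i : ℂ)) ?_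
  have : Measurable fun p : ℝ × ℝ => u p.1 p.2 := hu
  change Measurable fun p : ℝ × ℝ => (u p.1 p.2 i : ℂ)
  fun_prop

lemma measurable_gagl_kernel {n : ℕ} {u : ℝ → ℝ → E n} (hu : Measurable (Function.uncurry u)) :
    Measurable fun p : ℝ × ℝ => gagl (u p.1) p.2 := by
  have : (fun p : ℝ × ℝ => gagl (u p.1) p.2) = fun p => (gaglE (u p.1) p.2).toReal := by
    funext p
    exact gagl_eq_toReal (hu.comp (measurable_const.prodMk measurable_id)) _
  rw [this]
  exact (measurable_gaglE_kernel hu).ennreal_toReal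

lemma gagl_nonneg {n : ℕ} (u : ℝ → E n) (x : ℝ) : 0 ≤ gagl u x :=
  integral_nonneg fun _ => div_nonneg (Finset.sum_nonneg fun _ _ => sq_nonneg _) (sq_nonneg _)

/-- A state of the flow at a fixed time. -/
structure IsState {n : ℕ} (u : ℝ → E n) : Prop where
  meas : Measurable u
  periodic : Function.Periodic u (2 * π)
  sphere : ∀ᵐ x ∂circMeasure, ‖u x‖ = 1
  finite : hHalf u < ⊤

lemma IsState.memLp {n : ℕ} {u : ℝ → E n} (hu : IsState u) (i : Fin n) :
    MemLp (fun x => u x i) 2 circMeasure := by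
  have := hu.meas
  refine MemLp.of_bound (by fun_prop) 1 ?_
  filter_upwards [hu.sphere] with x hx
  exact (PiLp.norm_apply_le (u x) i).trans hx.le

lemma summable_of_tsum_lt_top {n : ℕ} {c : ℤ → ℝ} (hc : ∀ k, 0 ≤ c k) {u : ℝ → E n}
    (h : ∑' k : ℤ, ENNReal.ofReal (c k) * ∑ i, (‖fcV u k i‖₊ : ℝ≥0∞) ^ 2 < ⊤) (i : Fin n) :
    Summable fun k : ℤ => c k * ‖fcV u k i‖ ^ 2 := by
  have h2 := ENNReal.summable_toReal h.ne
  refine Summable.of_nonneg_of_le (fun k => mul_nonneg (hc k) (sq_nonneg _)) (fun k => ?_) h2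
  have h3 : (∑ i, (‖fcV u k i‖₊ : ℝ≥0∞) ^ 2).toReal = ∑ i, ‖fcV u k i‖ ^ 2 := by
    rw [ENNReal.toReal_sum fun _ _ => by finiteness]
    simp
  rw [ENNReal.toReal_mul, ENNReal.toReal_ofReal (hc k), h3]
  exact mul_le_mul_of_nonneg_left (Finset.single_le_sum (f := fun i => ‖fcV u k i‖ ^ 2)
    (fun _ _ => sq_nonneg _) (Finset.mem_univ i)) (hc k)

lemma summable_of_hHalf {n : ℕ} {u : ℝ → E n} (h : hHalf u < ⊤) (i : Fin n) :
    Summable fun k : ℤ => (k.natAbs : ℝ) * ‖fcV u k i‖ ^ 2 :=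
  summable_of_tsum_lt_top (c := fun k => (k.natAbs : ℝ)) (fun _ => by positivity)
    (by simpa only [hHalf, ENNReal.ofReal_natCast] using h) i

lemma summable_of_hSob {n : ℕ} {u : ℝ → E n} (h : hSob 1 u < ⊤) (i : Fin n) :
    Summable fun k : ℤ => (k : ℝ) ^ 2 * ‖fcV u k i‖ ^ 2 := by
  have h1 := summable_of_tsum_lt_top (c := fun k => 1 + (k : ℝ) ^ 2) (fun _ => by positivity)
    (by simpa [hSob] using h) i
  refine Summable.of_nonneg_of_le (fun _ => by positivity) (fun k => ?_) h1
  gcongr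
  linarith

/-- Squared homogeneous `Ḣ¹` seminorm. -/
def hOne {n : ℕ} (u : ℝ → E n) : ℝ := ∑ i, ∑' k : ℤ, (k : ℝ) ^ 2 * ‖fcV u k i‖ ^ 2

lemma hOne_nonneg {n : ℕ} (u : ℝ → E n) : 0 ≤ hOne u :=
  Finset.sum_nonneg fun _ _ => tsum_nonneg fun _ => by positivity

lemma IsState.lintegral_gaglE {n : ℕ} {u : ℝ → E n} (hu : IsState u) :
    ∫⁻ x in circ, gaglE u x = ENNReal.ofReal (4 * π ^ 2) * hHalf u := by
  have hm := hu.meas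
  have hm' : ∀ i, Measurable fun y => (u y i : ℂ) := fun i => by fun_prop
  unfold gaglE
  rw [lintegral_finsetSum _ fun i _ => measurable_energyDensity (hm' i), hHalf]
  simp only [Finset.mul_sum]
  rw [Summable.tsum_finsetSum fun _ _ => ENNReal.summable, Finset.mul_sum]
  refine Finset.sum_congr rfl fun i _ => ?_
  rw [lintegral_energyDensity (fun x => by simp only [hu.periodic x]) (hm' i) (hu.memLp i).ofReal]
  rfl

lemma IsState.integrable_gagl {n : ℕ} {u : ℝ → E n} (hu : IsState u) :
    Integrable (gagl u) circMeasure := by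
  rw [show gagl u = fun x => (gaglE u x).toReal from funext (gagl_eq_toReal hu.meas)]
  have hm := hu.meas
  refine integrable_toReal_of_lintegral_ne_top
    (Finset.measurable_sum _ fun i _ => measurable_energyDensity (by fun_prop)).aemeasurable ?_
  rw [hu.lintegral_gaglE]
  exact (ENNReal.mul_lt_top ENNReal.ofReal_lt_top hu.finite).ne

lemma IsState.integral_gagl_le {n : ℕ} {u : ℝ → E n} (hu : IsState u) {c : ℝ} (hc : 0 ≤ c)
    (h : hHalf u ≤ ENNReal.ofReal c) : ∫ x in circ, gagl u x ≤ 4 * π ^ 2 * c := by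
  have h1 : ∫⁻ x in circ, gaglE u x ≤ ENNReal.ofReal (4 * π ^ 2 * c) := by
    rw [hu.lintegral_gaglE, ENNReal.ofReal_mul (p := 4 * π ^ 2) (by positivity)]
    exact mul_le_mul_right h _
  rw [integral_eq_lintegral_of_nonneg_ae (ae_of_all _ (gagl_nonneg u))
    hu.integrable_gagl.aestronglyMeasurable]
  refine ENNReal.toReal_le_of_le_ofReal (by positivity) (le_trans (lintegral_mono fun x => ?_) h1)
  rw [gagl_eq_toReal hu.meas]
  exact ENNReal.ofReal_toReal_le

lemma IsState.gagl_le {n : ℕ} {u : ℝ → E n} (hu : IsState u) (h1 : hSob 1 u < ⊤) :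
    ∀ᵐ x ∂circMeasure, gagl u x ≤ 8 * π * hOne u := by
  have h := ae_all_iff.2 fun i => energyDensity_le (hu.memLp i).ofReal (summable_of_hSob h1 i)
  filter_upwards [h] with x hx
  rw [gagl_eq_toReal hu.meas]
  refine ENNReal.toReal_le_of_le_ofReal (mul_nonneg (by positivity) (hOne_nonneg u)) ?_
  rw [hOne, Finset.mul_sum, ENNReal.ofReal_sum_of_nonneg fun i _ =>
    mul_nonneg (by positivity) (tsum_nonneg fun _ => by positivity)]
  exact Finset.sum_le_sum fun i _ => hx i

/-- The right-hand side `|d_{1/2}u|² u` of the flow. -/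
def reaction {n : ℕ} (u : ℝ → E n) (i : Fin n) (x : ℝ) : ℝ := gagl u x * u x i

/-- A time slice of an `H¹` solution of small energy, with the equation in Fourier space. -/
structure IsSlice {n : ℕ} (u w : ℝ → E n) : Prop extends IsState u where
  sob : hSob 1 u < ⊤
  small : hHalf u ≤ ENNReal.ofReal (1 / 16)
  wMemLp : ∀ i, MemLp (fun x => w x i) 2 circMeasure
  equation : ∀ k i, fcV w k i + (2 * π * k.natAbs : ℝ) * fcV u k i = fcR (reaction u i) k

section Slice

variable {n : ℕ} {u v w z : ℝ → E n}

lemma sum_sq_eq_one {a : E n} (h : ‖a‖ = 1) : ∑ i, a i ^ 2 = 1 := by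
  have := EuclideanSpace.norm_sq_eq a
  simpa [h] using this.symm

lemma IsState.abs_le_one (hu : IsState u) (i : Fin n) : ∀ᵐ x ∂circMeasure, |u x i| ≤ 1 := by
  filter_upwards [hu.sphere] with x hx
  exact (PiLp.norm_apply_le (u x) i).trans hx.le

lemma IsState.measurable_apply (hu : IsState u) (i : Fin n) : Measurable fun x => u x i := by
  have := hu.meas
  fun_prop

lemma IsSlice.memLp_reaction (hu : IsSlice u w) (i : Fin n) :
    MemLp (reaction u i) 2 circMeasure := by
  refine MemLp.of_bound (hu.integrable_gagl.aestronglyMeasurable.mul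
    (hu.measurable_apply i).aestronglyMeasurable) (8 * π * hOne u * 1) ?_
  filter_upwards [hu.gagl_le hu.sob, hu.abs_le_one i] with x hx hx1
  rw [reaction, norm_mul, norm_of_nonneg (gagl_nonneg u x), norm_eq_abs]
  exact mul_le_mul hx hx1 (abs_nonneg _) (mul_nonneg (by positivity) (hOne_nonneg u))

lemma IsSlice.sum_integral_reaction_sq_le (hu : IsSlice u w) :
    ∑ i, ∫ x in circ, reaction u i x ^ 2 ≤ 2 * π ^ 3 * hOne u := by
  rw [← integral_finsetSum _ fun i _ => (hu.memLp_reaction i).integrable_sq]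
  have h0 := hOne_nonneg u
  have h1 : ∫ x in circ, ∑ i, reaction u i x ^ 2 ≤ ∫ x in circ, (8 * π * hOne u) * gagl u x := by
    refine integral_mono_ae (integrable_finsetSum _ fun i _ => (hu.memLp_reaction i).integrable_sq)
      (hu.integrable_gagl.const_mul _) ?_
    filter_upwards [hu.gagl_le hu.sob, hu.sphere] with x hx hx1
    simp only [reaction, mul_pow]
    rw [← Finset.mul_sum, sum_sq_eq_one hx1, mul_one, sq]
    exact mul_le_mul_of_nonneg_right hx (gagl_nonneg u x)
  have h2 := hu.integral_gagl_le (by norm_num) hu.small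
  rw [integral_const_mul] at h1
  refine h1.trans ((mul_le_mul_of_nonneg_left h2 (by positivity)).trans (le_of_eq ?_))
  ring

/-- The `H¹` norm of a slice is controlled by the time derivative. -/
lemma IsSlice.hOne_le (hu : IsSlice u w) :
    2 * π ^ 3 * hOne u ≤ ∑ i, ∫ x in circ, w x i ^ 2 := by
  have hcomp : ∀ i, 4 * π ^ 2 * ∑' k : ℤ, (k : ℝ) ^ 2 * ‖fcV u k i‖ ^ 2 ≤
      π⁻¹ * ((∫ x in circ, reaction u i x ^ 2) + ∫ x in circ, w x i ^ 2) := by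
    intro i
    have h1 := (summable_of_hSob hu.sob i).hasSum.mul_left (4 * π ^ 2)
    have h2 := ((hasSum_sq_fcR (hu.memLp_reaction i)).add (hasSum_sq_fcR (hu.wMemLp i))).mul_left 2
    refine (hasSum_le (fun k => ?_) h1 h2).trans (le_of_eq (by ring))
    have h3 : ((2 * π * k.natAbs : ℝ) : ℂ) * fcV u k i = fcR (reaction u i) k - fcV w k i := by
      rw [← hu.equation k i]; ring
    have h4 : 4 * π ^ 2 * ((k : ℝ) ^ 2 * ‖fcV u k i‖ ^ 2) =
        ‖((2 * π * k.natAbs : ℝ) : ℂ) * fcV u k i‖ ^ 2 := by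
      rw [norm_mul, Complex.norm_real, mul_pow, norm_eq_abs, sq_abs, mul_pow, Nat.cast_natAbs,
        Int.cast_abs, sq_abs]
      ring
    rw [h4, h3]
    have h5 := norm_sub_le (fcR (reaction u i) k) (fcV w k i)
    have h6 : ‖fcR (reaction u i) k - fcV w k i‖ ^ 2 ≤
        (‖fcR (reaction u i) k‖ + ‖fcV w k i‖) ^ 2 := by gcongr
    refine h6.trans ?_
    change _ ≤ 2 * (‖fcR (reaction u i) k‖ ^ 2 + ‖fcV w k i‖ ^ 2)
    nlinarith [sq_nonneg (‖fcR (reaction u i) k‖ - ‖fcV w k i‖)]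
  have hsum := Finset.sum_le_sum fun i (_ : i ∈ Finset.univ) => hcomp i
  rw [← Finset.mul_sum, ← Finset.mul_sum, Finset.sum_add_distrib] at hsum
  change 4 * π ^ 2 * hOne u ≤ _ at hsum
  have h7 := hu.sum_integral_reaction_sq_le
  have hpi := pi_pos
  have h8 : π * (4 * π ^ 2 * hOne u) ≤
      (∑ i, ∫ x in circ, reaction u i x ^ 2) + ∑ i, ∫ x in circ, w x i ^ 2 := by
    have := mul_le_mul_of_nonneg_left hsum hpi.le
    rwa [← mul_assoc π π⁻¹, mul_inv_cancel₀ hpi.ne', one_mul] at this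
  nlinarith

/-- Differential inequality for the difference of two slices. -/
lemma IsSlice.sum_integral_sub_mul_le (hu : IsSlice u w) (hv : IsSlice v z) :
    ∑ i, ∫ x in circ, (u x i - v x i) * (w x i - z x i) ≤
      4 * π * (hOne u + hOne v) * ∑ i, ∫ x in circ, (u x i - v x i) ^ 2 := by
  have hD : ∀ i, MemLp (fun x => u x i - v x i) 2 circMeasure := fun i =>
    (hu.memLp i).sub (hv.memLp i)
  have hW : ∀ i, MemLp (fun x => w x i - z x i) 2 circMeasure := fun i =>
    (hu.wMemLp i).sub (hv.wMemLp i)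
  have hG : ∀ i, MemLp (fun x => reaction u i x - reaction v i x) 2 circMeasure := fun i =>
    (hu.memLp_reaction i).sub (hv.memLp_reaction i)
  have hcomp : ∀ i, ∫ x in circ, (u x i - v x i) * (w x i - z x i) ≤
      ∫ x in circ, (u x i - v x i) * (reaction u i x - reaction v i x) := by
    intro i
    have h1 := hasSum_le (fun k => ?_) (hasSum_inner_fcR (hD i) (hW i))
      (hasSum_inner_fcR (hD i) (hG i))
    · exact le_of_mul_le_mul_left h1 (by positivity)
    · rw [fcR_sub ((hu.memLp i).integrable one_le_two) ((hv.memLp i).integrable one_le_two),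
        fcR_sub ((hu.wMemLp i).integrable one_le_two) ((hv.wMemLp i).integrable one_le_two),
        fcR_sub ((hu.memLp_reaction i).integrable one_le_two)
          ((hv.memLp_reaction i).integrable one_le_two), ← hu.equation k i, ← hv.equation k i]
      change ((fcV u k i - fcV v k i) * (starRingEnd ℂ) (fcV w k i - fcV z k i)).re ≤
        ((fcV u k i - fcV v k i) * (starRingEnd ℂ) _).re
      have h2 : fcV w k i + (2 * π * k.natAbs : ℝ) * fcV u k i -
          (fcV z k i + (2 * π * k.natAbs : ℝ) * fcV v k i) = (fcV w k i - fcV z k i) +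
          (2 * π * k.natAbs : ℝ) * (fcV u k i - fcV v k i) := by ring
      rw [h2, map_add, mul_add, Complex.add_re, map_mul, Complex.conj_ofReal, mul_left_comm,
        Complex.mul_conj, ← Complex.ofReal_mul, Complex.ofReal_re]
      have := Complex.normSq_nonneg (fcV u k i - fcV v k i)
      have : 0 ≤ 2 * π * k.natAbs * Complex.normSq (fcV u k i - fcV v k i) := by positivity
      linarith
  have hDG : ∀ i, Integrable (fun x => (u x i - v x i) * (reaction u i x - reaction v i x))
      circMeasure := fun i => (hD i).integrable_mul (hG i)
  have hDi : ∀ i, Integrable (fun x => (u x i - v x i) ^ 2) circMeasure := fun i =>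
    (hD i).integrable_sq
  refine (Finset.sum_le_sum fun i _ => hcomp i).trans ?_
  rw [← integral_finsetSum _ fun i _ => hDG i,
    ← integral_finsetSum _ fun i _ => hDi i, ← integral_const_mul]
  refine integral_mono_ae (integrable_finsetSum _ fun i _ => hDG i)
    ((integrable_finsetSum _ fun i _ => hDi i).const_mul _) ?_
  filter_upwards [hu.gagl_le hu.sob, hv.gagl_le hv.sob, hu.sphere, hv.sphere] with x h1 h2 h3 h4
  have e1 := sum_sq_eq_one h3
  have e2 := sum_sq_eq_one h4
  have e3 : ∑ i, (u x i - v x i) ^ 2 = 2 - 2 * ∑ i, u x i * v x i := by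
    simp only [sub_sq, Finset.sum_add_distrib, Finset.sum_sub_distrib, e1, e2, mul_assoc,
      ← Finset.mul_sum]
    ring
  have e4 : ∑ i, (u x i - v x i) * (reaction u i x - reaction v i x) =
      (gagl u x + gagl v x) * (1 - ∑ i, u x i * v x i) := by
    have : ∀ i, (u x i - v x i) * (reaction u i x - reaction v i x) =
        gagl u x * u x i ^ 2 + gagl v x * v x i ^ 2
          - (gagl u x + gagl v x) * (u x i * v x i) := fun i => by
      simp only [reaction]; ring
    simp only [this, Finset.sum_add_distrib, Finset.sum_sub_distrib, ← Finset.mul_sum, e1, e2]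
    ring
  rw [e4]
  have e5 : 0 ≤ ∑ i, (u x i - v x i) ^ 2 := Finset.sum_nonneg fun _ _ => sq_nonneg _
  rw [e3] at e5 ⊢
  nlinarith

end Slice

/-- Lebesgue measure on positive times. -/
abbrev timeMeasure : Measure ℝ := volume.restrict (Set.Ioi 0)

lemma measurable_fcR_kernel {F : ℝ → ℝ → ℝ} (hF : Measurable (Function.uncurry F)) (k : ℤ) :
    Measurable fun t => fcR (F t) k := by
  unfold fcR fc
  refine Measurable.const_mul (StronglyMeasurable.measurable ?_) _
  refine StronglyMeasurable.integral_prod_right (f := fun t x =>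
    (F t x : ℂ) * Complex.exp (-(Complex.I * (k : ℂ) * (x : ℂ)))) (Measurable.stronglyMeasurable ?_)
  have : Measurable fun p : ℝ × ℝ => F p.1 p.2 := hF
  change Measurable fun p : ℝ × ℝ =>
    (F p.1 p.2 : ℂ) * Complex.exp (-(Complex.I * (k : ℂ) * (p.2 : ℂ)))
  fun_prop

lemma measurable_fcV_kernel {n : ℕ} {u : ℝ → ℝ → E n} (hu : Measurable (Function.uncurry u))
    (k : ℤ) (i : Fin n) : Measurable fun t => fcV (u t) k i := by
  refine measurable_fcR_kernel (F := fun t x => u t x i) ?_ k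
  have : Measurable fun p : ℝ × ℝ => u p.1 p.2 := hu
  change Measurable fun p : ℝ × ℝ => u p.1 p.2 i
  fun_prop

lemma norm_fcR_le {f g : ℝ → ℝ} (hg : Integrable g circMeasure)
    (h : ∀ᵐ x ∂circMeasure, |f x| ≤ g x) (k : ℤ) :
    ‖fcR f k‖ ≤ (2 * π)⁻¹ * ∫ x in circ, g x := by
  rw [fcR, fc, norm_mul, Complex.norm_real, one_div, norm_of_nonneg (by positivity)]
  gcongr
  refine norm_integral_le_of_norm_le hg ?_
  filter_upwards [h] with x hx
  rwa [norm_mul, norm_exp_neg_I_mul, mul_one, Complex.norm_real]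

lemma isSTTest_single_mode {n : ℕ} {η : ℝ → ℝ} (hη : ContDiff ℝ (⊤ : ℕ∞) η)
    (hc : HasCompactSupport η) (hs : tsupport η ⊆ Set.Ioi 0) (i : Fin n) (z : ℂ) (m : ℤ) :
    IsSTTest n fun t x => EuclideanSpace.single i (η t * mode z m x) where
  smooth := by
    have hm : ContDiff ℝ (⊤ : ℕ∞) fun p : ℝ × ℝ => mode z m p.2 := by
      unfold mode
      refine Complex.reCLM.contDiff.comp (contDiff_const.mul (ContDiff.cexp ?_))
      exact contDiff_const.mul (Complex.ofRealCLM.contDiff.comp contDiff_snd)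
    refine contDiff_euclidean.2 fun j => ?_
    simp only [PiLp.single_apply]
    split_ifs
    · exact (hη.comp contDiff_fst).mul hm
    · exact contDiff_const
  periodic t x := by simp only [mode_periodic z m x]
  suppTime := by
    have hz : ∀ t, t ∉ tsupport η → ∀ x, (EuclideanSpace.single i (η t * mode z m x) : E n) = 0 :=
      fun t ht x => by simp [image_eq_zero_of_notMem_tsupport ht]
    rcases (tsupport η).eq_empty_or_nonempty with h | h
    · exact ⟨1, 1, one_pos, fun t _ => hz t (by simp [h])⟩
    · obtain ⟨a, ha⟩ := IsCompact.exists_isLeast hc h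
      obtain ⟨b, hb⟩ := IsCompact.exists_isGreatest hc h
      exact ⟨a, b, hs ha.1, fun t ht => hz t fun h' => ht ⟨ha.2 h', hb.2 h'⟩⟩

namespace IsEnergySolAux

variable {n : ℕ} {u₀ : ℝ → E n} {u w : ℝ → ℝ → E n}

lemma measurable_slice (hu : IsEnergySolAux n u₀ u w) (t : ℝ) : Measurable (u t) :=
  hu.meas.comp measurable_prodMk_left

lemma measurable_wslice (hu : IsEnergySolAux n u₀ u w) (t : ℝ) : Measurable (w t) :=
  hu.wMeas.comp measurable_prodMk_left

lemma ae_isState (hu : IsEnergySolAux n u₀ u w) : ∀ᵐ t ∂timeMeasure, IsState (u t) := by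
  obtain ⟨M, hM, hb⟩ := hu.energyBdd
  filter_upwards [hb, Measure.ae_ae_of_ae_prod hu.sphere] with t h1 h2
  exact ⟨hu.measurable_slice t, hu.periodic t, h2, h1.trans_lt hM⟩

lemma measurable_lintegral_w (hu : IsEnergySolAux n u₀ u w) :
    Measurable fun t => ∫⁻ x in circ, ‖w t x‖ₑ ^ 2 := by
  have h : Measurable fun p : ℝ × ℝ => ‖w p.1 p.2‖ₑ ^ 2 := (hu.wMeas.enorm).pow_const 2
  exact h.lintegral_prod_right'

lemma ae_lintegral_w_lt_top (hu : IsEnergySolAux n u₀ u w) :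
    ∀ᵐ t ∂timeMeasure, ∫⁻ x in circ, ‖w t x‖ₑ ^ 2 < ⊤ :=
  ae_lt_top hu.measurable_lintegral_w hu.wL2.ne

lemma enorm_apply_sq_le (a : E n) (i : Fin n) : ‖a i‖ₑ ^ 2 ≤ ‖a‖ₑ ^ 2 := by
  rw [enorm_sq_eq_ofReal, enorm_sq_eq_ofReal]
  have := PiLp.norm_apply_le a i
  gcongr

lemma ae_memLp_w (hu : IsEnergySolAux n u₀ u w) :
    ∀ᵐ t ∂timeMeasure, ∀ i, MemLp (fun x => w t x i) 2 circMeasure := by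
  filter_upwards [hu.ae_lintegral_w_lt_top] with t ht i
  have hm := hu.measurable_wslice t
  have hm' : Measurable fun x => w t x i := by fun_prop
  rw [memLp_two_iff_integrable_sq_norm hm'.aestronglyMeasurable,
    ← lintegral_ofReal_ne_top_iff_integrable (hm'.norm.pow_const 2).aestronglyMeasurable
      (ae_of_all _ fun _ => by positivity)]
  simp only [← enorm_sq_eq_ofReal]
  exact ((lintegral_mono fun x => enorm_apply_sq_le (w t x) i).trans_lt ht).ne

lemma memLp_fcV_w (hu : IsEnergySolAux n u₀ u w) (k : ℤ) (i : Fin n) :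
    MemLp (fun t => fcV (w t) k i) 2 timeMeasure := by
  have hm := measurable_fcV_kernel hu.wMeas k i
  rw [memLp_two_iff_integrable_sq_norm hm.aestronglyMeasurable,
    ← lintegral_ofReal_ne_top_iff_integrable (hm.norm.pow_const 2).aestronglyMeasurable
      (ae_of_all _ fun _ => by positivity)]
  simp only [← enorm_sq_eq_ofReal]
  refine (lt_of_le_of_lt (lintegral_mono_ae (g := fun t =>
    ENNReal.ofReal (2 * π)⁻¹ * ∫⁻ x in circ, ‖w t x‖ₑ ^ 2) ?_) ?_).ne
  · filter_upwards [hu.ae_memLp_w] with t ht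
    refine (ENNReal.le_tsum k).trans ((tsum_enorm_sq_fc (ht i).ofReal).le.trans ?_)
    gcongr with x
    rw [← ofReal_norm, ← ofReal_norm, RCLike.norm_ofReal]
    exact ENNReal.ofReal_le_ofReal (PiLp.norm_apply_le (w t x) i)
  · rw [lintegral_const_mul _ hu.measurable_lintegral_w]
    exact ENNReal.mul_lt_top ENNReal.ofReal_lt_top hu.wL2

lemma memLp_top_fcV (hu : IsEnergySolAux n u₀ u w) (k : ℤ) (i : Fin n) :
    MemLp (fun t => fcV (u t) k i) ⊤ timeMeasure := by
  refine memLp_top_of_bound (measurable_fcV_kernel hu.meas k i).aestronglyMeasurable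
    ((2 * π)⁻¹ * ∫ x in circ, (1 : ℝ)) ?_
  filter_upwards [hu.ae_isState] with t ht
  exact norm_fcR_le (integrable_const _) (ht.abs_le_one i) k

lemma memLp_top_reaction (hu : IsEnergySolAux n u₀ u w)
    (hs : ∀ᵐ t ∂timeMeasure, hHalf (u t) ≤ ENNReal.ofReal (1 / 16)) (k : ℤ) (i : Fin n) :
    MemLp (fun t => fcR (reaction (u t) i) k) ⊤ timeMeasure := by
  refine memLp_top_of_bound (Measurable.aestronglyMeasurable ?_)
    ((2 * π)⁻¹ * (4 * π ^ 2 * (1 / 16))) ?_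
  · refine measurable_fcR_kernel (F := fun t => reaction (u t) i) ?_ k
    have : Measurable fun p : ℝ × ℝ => u p.1 p.2 := hu.meas
    have h2 := measurable_gagl_kernel hu.meas
    change Measurable fun p : ℝ × ℝ => gagl (u p.1) p.2 * u p.1 p.2 i
    fun_prop
  · filter_upwards [hu.ae_isState, hs] with t ht h1
    refine (norm_fcR_le ht.integrable_gagl ?_ k).trans ?_
    · filter_upwards [ht.abs_le_one i] with x hx
      rw [reaction, abs_mul, abs_of_nonneg (gagl_nonneg _ _)]
      exact mul_le_of_le_one_right (gagl_nonneg _ _) hx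
    · gcongr
      exact ht.integral_gagl_le (by norm_num) h1

/-- The flow equation, mode by mode. -/
lemma ae_equation_mode (hu : IsEnergySolAux n u₀ u w)
    (hs : ∀ᵐ t ∂timeMeasure, hHalf (u t) ≤ ENNReal.ofReal (1 / 16)) (k : ℤ) (i : Fin n) (z : ℂ) :
    ∀ᵐ t ∂timeMeasure, ((fcV (w t) k i + (2 * π * k.natAbs : ℝ) * fcV (u t) k i
      - fcR (reaction (u t) i) k) * (starRingEnd ℂ) z).re = 0 := by
  have hP := ((hu.memLp_fcV_w k i).locallyIntegrable one_le_two)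
  have hQ := ((hu.memLp_top_fcV k i).locallyIntegrable le_top)
  have hR := ((hu.memLp_top_reaction hs k i).locallyIntegrable le_top)
  have hre : ∀ {f : ℝ → ℂ} (c : ℝ), LocallyIntegrable f timeMeasure →
      LocallyIntegrable (fun t => c * (f t * (starRingEnd ℂ) z).re) timeMeasure := by
    intro f c hf x
    obtain ⟨s, hs, h⟩ := hf x
    exact ⟨s, hs, ((h.mul_const _).re).const_mul c⟩
  have hP' := hre (2 * π) hP
  have hQ' := hre (4 * π ^ 2 * k.natAbs) hQ
  have hR' := hre (2 * π) hR
  have hloc : LocallyIntegrable (fun t => 2 * π * (fcV (w t) k i * (starRingEnd ℂ) z).re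
    + 4 * π ^ 2 * k.natAbs * (fcV (u t) k i * (starRingEnd ℂ) z).re
    - 2 * π * (fcR (reaction (u t) i) k * (starRingEnd ℂ) z).re) timeMeasure := (hP'.add hQ').sub hR'
  have h := isOpen_Ioi.ae_eq_zero_of_integral_contDiff_smul_eq_zero (U := Set.Ioi (0 : ℝ))
    (hloc.locallyIntegrableOn _) fun η h1 h2 h3 => ?_
  · filter_upwards [h, ae_restrict_mem measurableSet_Ioi] with t ht ht0
    have := ht ht0
    have h2 : 2 * π * ((fcV (w t) k i + (2 * π * k.natAbs : ℝ) * fcV (u t) k i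
      - fcR (reaction (u t) i) k) * (starRingEnd ℂ) z).re = 0 := by
      rw [← this, sub_mul, add_mul, Complex.sub_re, Complex.add_re,
        mul_assoc ((2 * π * k.natAbs : ℝ) : ℂ), Complex.re_ofReal_mul]
      ring
    exact (mul_eq_zero.1 h2).resolve_left (by positivity)
  · have hfl := hu.flow _ (isSTTest_single_mode h1 h2 h3 i z k)
    have iP := hP'.integrable_smul_left_of_hasCompactSupport h1.continuous h2
    have iQ := hQ'.integrable_smul_left_of_hasCompactSupport h1.continuous h2
    have iR := hR'.integrable_smul_left_of_hasCompactSupport h1.continuous h2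
    have eP : ∫ t in Set.Ioi (0 : ℝ), ∫ x in circ, ∑ j, w t x j *
        (EuclideanSpace.single i (η t * mode z k x) : E n) j
        = ∫ t in Set.Ioi (0 : ℝ), η t • (2 * π * (fcV (w t) k i * (starRingEnd ℂ) z).re) := by
      refine integral_congr_ae ?_
      filter_upwards [hu.ae_memLp_w] with t ht
      simp only [sum_mul_single]
      rw [smul_eq_mul, fcV, ← integral_mul_mode ((ht i).integrable one_le_two), ← integral_const_mul]
      refine integral_congr_ae (ae_of_all _ fun x => ?_)
      simp only
      ring
    have eQ : ∫ t in Set.Ioi (0 : ℝ), pairing (u t) (fun x => EuclideanSpace.single i (η t * mode z k x))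
        = ∫ t in Set.Ioi (0 : ℝ), η t • (4 * π ^ 2 * k.natAbs * (fcV (u t) k i * (starRingEnd ℂ) z).re) := by
      refine integral_congr_ae ?_
      filter_upwards [hu.ae_isState] with t ht
      rw [pairing_single_mode ht.periodic ht.meas i (ht.memLp i) (summable_of_hHalf ht.finite i),
        smul_eq_mul]
      ring
    have eR : ∫ t in Set.Ioi (0 : ℝ), ∫ x in circ, gagl (u t) x * ∑ j, u t x j *
        (EuclideanSpace.single i (η t * mode z k x) : E n) j
        = ∫ t in Set.Ioi (0 : ℝ), η t • (2 * π * (fcR (reaction (u t) i) k * (starRingEnd ℂ) z).re) := by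
      refine integral_congr_ae ?_
      filter_upwards [hu.ae_isState] with t ht
      have hi : Integrable (reaction (u t) i) circMeasure := by
        refine ht.integrable_gagl.mul_bdd (c := 1) (ht.measurable_apply i).aestronglyMeasurable
          (ht.abs_le_one i)
      simp only [sum_mul_single]
      rw [smul_eq_mul, ← integral_mul_mode hi, ← integral_const_mul]
      refine integral_congr_ae (ae_of_all _ fun x => ?_)
      simp only [reaction]
      ring
    rw [eP, eQ, eR] at hfl
    have iPQ : Integrable (fun t => η t • (2 * π * (fcV (w t) k i * (starRingEnd ℂ) z).re) +
      η t • (4 * π ^ 2 * k.natAbs * (fcV (u t) k i * (starRingEnd ℂ) z).re)) timeMeasure := iP.add iQ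
    simp only [smul_sub, smul_add]
    rw [integral_sub iPQ iR, integral_add iP iQ, hfl, sub_self]

/-- Almost every time slice of a small-energy `H¹` solution is regular. -/
lemma ae_isSlice (hu : IsEnergySolAux n u₀ u w)
    (hH : ∀ᵐ t ∂timeMeasure, hSob 1 (u t) < ⊤)
    (hs : ∀ᵐ t ∂timeMeasure, hHalf (u t) ≤ ENNReal.ofReal (1 / 16)) :
    ∀ᵐ t ∂timeMeasure, IsSlice (u t) (w t) := by
  have h1 := ae_all_iff.2 fun k => ae_all_iff.2 fun i => hu.ae_equation_mode hs k i 1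
  have h2 := ae_all_iff.2 fun k => ae_all_iff.2 fun i => hu.ae_equation_mode hs k i Complex.I
  filter_upwards [hu.ae_isState, hH, hs, hu.ae_memLp_w, h1, h2] with t a1 a2 a3 a4 a5 a6
  refine ⟨a1, a2, a3, a4, fun k i => sub_eq_zero.1 ?_⟩
  have e1 := a5 k i
  have e2 := a6 k i
  rw [map_one, mul_one] at e1
  rw [Complex.conj_I, mul_neg, Complex.neg_re, Complex.mul_I_re, neg_neg] at e2
  exact Complex.ext e1 e2

/-- The weak time derivative, mode by mode. -/
lemma weakDeriv_mode (hu : IsEnergySolAux n u₀ u w) (k : ℤ) (i : Fin n) (z : ℂ) {η : ℝ → ℝ}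
    (h1 : ContDiff ℝ (⊤ : ℕ∞) η) (h2 : HasCompactSupport η) (h3 : tsupport η ⊆ Set.Ioi 0) :
    ∫ t in Set.Ioi (0 : ℝ), deriv η t * (fcV (u t) k i * (starRingEnd ℂ) z).re
      = - ∫ t in Set.Ioi (0 : ℝ), η t * (fcV (w t) k i * (starRingEnd ℂ) z).re := by
  have h := hu.weakDeriv _ (isSTTest_single_mode h1 h2 h3 i z k)
  have eU : ∫ t in Set.Ioi (0 : ℝ), ∫ x in circ, ∑ j, u t x j *
      deriv (fun s => (EuclideanSpace.single i (η s * mode z k x) : E n) j) t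
      = 2 * π * ∫ t in Set.Ioi (0 : ℝ), deriv η t * (fcV (u t) k i * (starRingEnd ℂ) z).re := by
    rw [← integral_const_mul]
    refine integral_congr_ae ?_
    filter_upwards [hu.ae_isState] with t ht
    have hd : ∀ x j, deriv (fun s => (EuclideanSpace.single i (η s * mode z k x) : E n) j) t
        = (EuclideanSpace.single i (deriv η t * mode z k x) : E n) j := by
      intro x j
      simp only [PiLp.single_apply]
      split_ifs
      · exact deriv_mul_const ((h1.differentiable (by simp)) t) _
      · simp
    simp only [hd, sum_mul_single]
    rw [mul_left_comm, fcV, ← integral_mul_mode ((ht.memLp i).integrable one_le_two),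
      ← integral_const_mul]
    refine integral_congr_ae (ae_of_all _ fun x => ?_)
    simp only
    ring
  have eW : ∫ t in Set.Ioi (0 : ℝ), ∫ x in circ, ∑ j, w t x j *
      (EuclideanSpace.single i (η t * mode z k x) : E n) j
      = 2 * π * ∫ t in Set.Ioi (0 : ℝ), η t * (fcV (w t) k i * (starRingEnd ℂ) z).re := by
    rw [← integral_const_mul]
    refine integral_congr_ae ?_
    filter_upwards [hu.ae_memLp_w] with t ht
    simp only [sum_mul_single]
    rw [mul_left_comm, fcV, ← integral_mul_mode ((ht i).integrable one_le_two), ← integral_const_mul]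
    refine integral_congr_ae (ae_of_all _ fun x => ?_)
    simp only
    ring
  rw [eU, eW, ← mul_neg] at h
  exact mul_left_cancel₀ (by positivity) h

end IsEnergySolAux

section WeakDerivative

variable {α β : ℝ → ℝ}

lemma intervalIntegrable_of_timeMeasure (hβ : LocallyIntegrable β timeMeasure) {T : ℝ} (hT : 0 ≤ T) :
    IntervalIntegrable β volume 0 T := by
  rw [intervalIntegrable_iff_integrableOn_Ioc_of_le hT]
  have h := hβ.integrableOn_isCompact (isCompact_Icc (a := 0) (b := T))
  rw [IntegrableOn, Measure.restrict_restrict measurableSet_Icc] at h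
  refine IntegrableOn.mono_set h fun x hx => ?_
  exact ⟨⟨hx.1.le, hx.2⟩, hx.1⟩

lemma continuousOn_primitive (hβ : LocallyIntegrable β timeMeasure) :
    ContinuousOn (fun t => ∫ s in 0..t, β s) (Set.Ici 0) := fun t ht => by
  have ht' : (0 : ℝ) ≤ t + 1 := by linarith [Set.mem_Ici.1 ht]
  have h1 := ((intervalIntegrable_of_timeMeasure hβ ht').absolutelyContinuousOnInterval_intervalIntegral
    (c := 0) Set.left_mem_uIcc).continuousOn t
      (by rw [Set.uIcc_of_le ht']; exact ⟨ht, by linarith⟩)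
  refine h1.mono_of_mem_nhdsWithin ?_
  rw [Set.uIcc_of_le ht', ← Set.Ici_inter_Iic]
  exact inter_mem_nhdsWithin _ (Iic_mem_nhds (by linarith))

lemma setIntegral_Ioi_eq_of_zero {f : ℝ → ℝ} {T : ℝ} (hT : 0 ≤ T) (hf : ∀ t, T < t → f t = 0) :
    ∫ t in Set.Ioi 0, f t = ∫ t in 0..T, f t := by
  rw [intervalIntegral.integral_of_le hT]
  exact setIntegral_eq_of_subset_of_forall_sdiff_eq_zero measurableSet_Ioi
    Set.Ioc_subset_Ioi_self fun t ht => hf t (not_le.1 fun h => ht.2 ⟨ht.1, h⟩)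

lemma exists_subset_Icc_of_compact {K : Set ℝ} (hK : IsCompact K) (h0 : K ⊆ Set.Ioi 0) :
    ∃ a b, 0 < a ∧ a ≤ b ∧ K ⊆ Set.Icc a b := by
  rcases K.eq_empty_or_nonempty with rfl | h
  · exact ⟨1, 1, one_pos, le_rfl, Set.empty_subset _⟩
  · obtain ⟨a, ha⟩ := hK.exists_isLeast h
    obtain ⟨b, hb⟩ := hK.exists_isGreatest h
    exact ⟨a, b, h0 ha.1, ha.2 hb.1, fun t ht => ⟨ha.2 ht, hb.2 ht⟩⟩

/-- Integration by parts against a primitive. -/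
lemma integral_deriv_mul_primitive (hβ : LocallyIntegrable β timeMeasure) {η : ℝ → ℝ}
    (h1 : ContDiff ℝ (⊤ : ℕ∞) η) (h2 : HasCompactSupport η) (h3 : tsupport η ⊆ Set.Ioi 0) :
    ∫ t in Set.Ioi (0 : ℝ), deriv η t * ∫ s in 0..t, β s
      = - ∫ t in Set.Ioi (0 : ℝ), η t * β t := by
  obtain ⟨a, b, ha, hab, hK⟩ := exists_subset_Icc_of_compact h2 h3
  have hz : ∀ t, t ∉ Set.Icc a b → η t = 0 := fun t ht =>
    image_eq_zero_of_notMem_tsupport fun h => ht (hK h)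
  have hdz : ∀ t, t ∉ Set.Icc a b → deriv η t = 0 := fun t ht =>
    image_eq_zero_of_notMem_tsupport fun h => ht (hK (tsupport_deriv_subset h))
  have hT : (0 : ℝ) ≤ b + 1 := by linarith
  have hout : ∀ t, b + 1 < t → t ∉ Set.Icc a b := fun t ht h => by linarith [h.2]
  rw [setIntegral_Ioi_eq_of_zero hT fun t ht => by rw [hdz t (hout t ht), zero_mul],
    setIntegral_Ioi_eq_of_zero hT fun t ht => by rw [hz t (hout t ht), zero_mul]]
  have hi := intervalIntegrable_of_timeMeasure hβ hT
  have hB := hi.absolutelyContinuousOnInterval_intervalIntegral (c := 0) Set.left_mem_uIcc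
  have hη : AbsolutelyContinuousOnInterval η 0 (b + 1) :=
    ContDiffOn.absolutelyContinuousOnInterval
      (h1.of_le (by exact_mod_cast le_top)).contDiffOn
  have h := hη.integral_mul_deriv_eq_deriv_mul hB
  rw [hz 0 fun h => by linarith [h.1], hz (b + 1) fun h => by linarith [h.2]] at h
  have he : ∫ t in 0..(b + 1), η t * β t
      = ∫ t in 0..(b + 1), η t * deriv (fun x => ∫ s in 0..x, β s) t := by
    refine intervalIntegral.integral_congr_ae ?_
    filter_upwards [hi.ae_hasDerivAt_integral] with t ht hm
    rw [(ht (Set.uIoc_subset_uIcc hm) 0 Set.left_mem_uIcc).deriv]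
  rw [he, h]
  ring

/-- A smooth function with zero mean is the derivative of a test function. -/
lemma exists_primitive_test {ψ : ℝ → ℝ} (h1 : ContDiff ℝ (⊤ : ℕ∞) ψ) (h2 : HasCompactSupport ψ)
    (h3 : tsupport ψ ⊆ Set.Ioi 0) (h0 : ∫ t in Set.Ioi 0, ψ t = 0) :
    ∃ η : ℝ → ℝ, ContDiff ℝ (⊤ : ℕ∞) η ∧ HasCompactSupport η ∧ tsupport η ⊆ Set.Ioi 0 ∧
      deriv η = ψ := by
  obtain ⟨a, b, ha, hab, hK⟩ := exists_subset_Icc_of_compact h2 h3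
  have hz : ∀ t, t ∉ Set.Icc a b → ψ t = 0 := fun t ht =>
    image_eq_zero_of_notMem_tsupport fun h => ht (hK h)
  have hd : ∀ t, HasDerivAt (fun x => ∫ s in 0..x, ψ s) (ψ t) t := fun t =>
    h1.continuous.integral_hasStrictDerivAt 0 t |>.hasDerivAt
  have hder : deriv (fun x => ∫ s in 0..x, ψ s) = ψ := funext fun t => (hd t).deriv
  have hs : tsupport (fun x => ∫ s in 0..x, ψ s) ⊆ Set.Icc a b := by
    refine closure_minimal (fun t ht => ?_) isClosed_Icc
    by_contra hn
    refine ht ?_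
    rw [Set.mem_Icc, not_and_or, not_le, not_le] at hn
    rcases hn with hn | hn
    · refine (intervalIntegral.integral_congr fun s hs => ?_).trans intervalIntegral.integral_zero
      refine hz s fun h => ?_
      have := hs.2
      have := max_lt ha hn
      linarith [h.1]
    · simp only
      rw [← setIntegral_Ioi_eq_of_zero (by linarith) fun s hs => hz s fun h => by linarith [h.2], h0]
  refine ⟨_, ?_, HasCompactSupport.of_support_subset_isCompact isCompact_Icc
    ((subset_tsupport _).trans hs), fun t ht => lt_of_lt_of_le ha (hs ht).1, hder⟩
  rw [contDiff_infty_iff_deriv, hder]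
  exact ⟨fun t => (hd t).differentiableAt, h1⟩

/-- A function whose weak derivative vanishes is constant. -/
lemma ae_eq_const_of_weakDeriv_zero {γ : ℝ → ℝ} (hγ : LocallyIntegrable γ timeMeasure)
    (h : ∀ η : ℝ → ℝ, ContDiff ℝ (⊤ : ℕ∞) η → HasCompactSupport η → tsupport η ⊆ Set.Ioi 0 →
      ∫ t in Set.Ioi (0 : ℝ), deriv η t * γ t = 0) :
    ∃ c, ∀ᵐ t ∂timeMeasure, γ t = c := by
  let f : ContDiffBump (2 : ℝ) := ⟨1 / 2, 1, by norm_num, by norm_num⟩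
  have hf0 : ∀ t, t ∉ Set.Ioi (0 : ℝ) → f.normed volume t = 0 := fun t ht => by
    refine Function.notMem_support.1 fun hm => ht ?_
    rw [f.support_normed_eq, Metric.mem_ball, Real.dist_eq, abs_lt] at hm
    have : f.rOut = 1 := rfl
    rw [Set.mem_Ioi]
    linarith [hm.1]
  have hf1 : ContDiff ℝ (⊤ : ℕ∞) (f.normed volume) := f.contDiff_normed
  have hf2 : HasCompactSupport (f.normed volume) := f.hasCompactSupport_normed
  have hf3 : tsupport (f.normed volume) ⊆ Set.Ioi 0 := fun t ht => by
    rw [f.tsupport_normed_eq, Metric.mem_closedBall, Real.dist_eq, abs_le] at ht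
    have : f.rOut = 1 := rfl
    rw [Set.mem_Ioi]
    linarith [ht.1]
  have hfi : ∫ t in Set.Ioi 0, f.normed volume t = 1 := by
    rw [setIntegral_eq_integral_of_forall_compl_eq_zero hf0, f.integral_normed]
  set ρ : ℝ → ℝ := f.normed volume with hρ
  refine ⟨∫ t in Set.Ioi 0, ρ t * γ t, ?_⟩
  have hint : ∀ {θ : ℝ → ℝ}, ContDiff ℝ (⊤ : ℕ∞) θ → HasCompactSupport θ →
      Integrable (fun t => θ t * γ t) timeMeasure := fun h1 h2 =>
    hγ.integrable_smul_left_of_hasCompactSupport h1.continuous h2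
  have hint' : ∀ {θ : ℝ → ℝ}, ContDiff ℝ (⊤ : ℕ∞) θ → HasCompactSupport θ →
      Integrable θ timeMeasure := fun h1 h2 =>
    (h1.continuous.integrable_of_hasCompactSupport h2).restrict
  have hloc : LocallyIntegrable (fun t => γ t - ∫ s in Set.Ioi 0, ρ s * γ s) timeMeasure :=
    hγ.sub (locallyIntegrable_const _)
  have key := isOpen_Ioi.ae_eq_zero_of_integral_contDiff_smul_eq_zero (U := Set.Ioi (0 : ℝ))
    (hloc.locallyIntegrableOn _) fun θ h1 h2 h3 => ?_
  · filter_upwards [key, ae_restrict_mem measurableSet_Ioi] with t ht h0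
    exact sub_eq_zero.1 (ht h0)
  · set m := ∫ t in Set.Ioi 0, θ t with hm
    have hmρ := hf2.mul_left (f := fun _ => m)
    obtain ⟨η, e1, e2, e3, e4⟩ := exists_primitive_test (ψ := fun t => θ t - m * ρ t)
      (h1.sub (contDiff_const.mul hf1)) (h2.sub hmρ)
      ((tsupport_sub _ _).trans (Set.union_subset h3
        ((tsupport_mul_subset_right).trans hf3)))
      (by rw [integral_sub (hint' h1 h2) ((hint' hf1 hf2).const_mul m), integral_const_mul, hfi,
        mul_one, sub_self])
    have hh := h η e1 e2 e3
    rw [e4] at hh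
    simp only [sub_mul, mul_assoc] at hh
    rw [integral_sub (hint h1 h2) ((hint hf1 hf2).const_mul m), integral_const_mul] at hh
    simp only [smul_eq_mul, mul_sub]
    rw [integral_sub (hint h1 h2) ((hint' h1 h2).mul_const _), integral_mul_const]
    exact hh

/-- The energy identity for a scalar function with weak derivative and zero initial value. -/
lemma ae_sq_eq_integral (hα : LocallyIntegrable α timeMeasure) (hβ : LocallyIntegrable β timeMeasure)
    (h : ∀ η : ℝ → ℝ, ContDiff ℝ (⊤ : ℕ∞) η → HasCompactSupport η → tsupport η ⊆ Set.Ioi 0 →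
      ∫ t in Set.Ioi (0 : ℝ), deriv η t * α t = - ∫ t in Set.Ioi (0 : ℝ), η t * β t)
    {m : ℝ → ℝ} (hm : Tendsto m (𝓝[>] 0) (𝓝 0)) (hαm : ∀ᵐ t ∂timeMeasure, |α t| ≤ m t) :
    ∀ᵐ t ∂timeMeasure, α t ^ 2 = 2 * ∫ s in 0..t, α s * β s := by
  set b : ℝ → ℝ := fun t => ∫ s in 0..t, β s with hb
  have hAC : ∀ {T : ℝ}, 0 ≤ T → AbsolutelyContinuousOnInterval b 0 T := fun hT =>
    (intervalIntegrable_of_timeMeasure hβ hT).absolutelyContinuousOnInterval_intervalIntegral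
      (c := 0) Set.left_mem_uIcc
  have hbc : ContinuousOn b (Set.Ici 0) := continuousOn_primitive hβ
  have hbl : LocallyIntegrable b timeMeasure := by
    rw [timeMeasure, restrict_Ioi_eq_restrict_Ici]
    exact (locallyIntegrableOn_iff_locallyIntegrable_restrict isClosed_Ici).1
      (hbc.locallyIntegrableOn measurableSet_Ici)
  obtain ⟨c, hc⟩ := ae_eq_const_of_weakDeriv_zero (γ := fun t => α t - b t) (hα.sub hbl)
    fun η h1 h2 h3 => by
      have hdc : Continuous (deriv η) := h1.continuous_deriv (by simp)
      have hds : HasCompactSupport (deriv η) := h2.deriv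
      have i1 : Integrable (fun t => deriv η t * α t) timeMeasure :=
        hα.integrable_smul_left_of_hasCompactSupport hdc hds
      have i2 : Integrable (fun t => deriv η t * b t) timeMeasure :=
        hbl.integrable_smul_left_of_hasCompactSupport hdc hds
      simp only [mul_sub]
      rw [integral_sub i1 i2, h η h1 h2 h3, integral_deriv_mul_primitive hβ h1 h2 h3, sub_self]
  have hb0 : Tendsto b (𝓝[>] 0) (𝓝 0) := by
    have := (hbc 0 Set.self_mem_Ici).mono Set.Ioi_subset_Ici_self
    simpa [ContinuousWithinAt, hb] using this
  have hc0 : c = 0 := by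
    by_contra hne
    have hlim : Tendsto (fun t => m t + |b t|) (𝓝[>] 0) (𝓝 0) := by
      simpa using hm.add hb0.abs
    obtain ⟨δ, hδ, hs⟩ := (mem_nhdsGT_iff_exists_Ioo_subset).1
      (hlim.eventually (gt_mem_nhds (abs_pos.2 hne)))
    have hae : ∀ᵐ t ∂timeMeasure, t ∉ Set.Ioo 0 δ := by
      filter_upwards [hc, hαm] with t h1 h2 hm
      have h3 := hs hm
      have h4 : |c| ≤ |α t| + |b t| := by rw [← h1]; exact abs_sub _ _
      have h5 : m t + |b t| < |c| := h3
      linarith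
    rw [ae_iff] at hae
    simp only [not_not, Set.ofPred_mem_eq] at hae
    rw [Measure.restrict_apply measurableSet_Ioo, Set.inter_eq_left.2 Set.Ioo_subset_Ioi_self,
      Real.volume_Ioo, ENNReal.ofReal_eq_zero] at hae
    linarith [Set.mem_Ioi.1 hδ]
  have hαb : ∀ᵐ t ∂timeMeasure, α t = b t := hc.mono fun t ht => by
    rw [hc0] at ht; exact sub_eq_zero.1 ht
  filter_upwards [hαb, ae_restrict_mem measurableSet_Ioi] with t ht h0
  have hT : (0 : ℝ) ≤ t := le_of_lt h0
  have hI : ∫ s in 0..t, α s * β s = ∫ s in 0..t, b s * deriv b s := by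
    rw [intervalIntegral.integral_of_le hT, intervalIntegral.integral_of_le hT]
    refine integral_congr_ae ?_
    filter_upwards [ae_restrict_of_ae_restrict_of_subset Set.Ioc_subset_Ioi_self hαb,
      ae_restrict_of_ae (intervalIntegrable_of_timeMeasure hβ hT).ae_hasDerivAt_integral,
      ae_restrict_mem measurableSet_Ioc] with s h1 h2 h3
    rw [h1, (h2 (by rw [Set.uIcc_of_le hT]; exact ⟨h3.1.le, h3.2⟩) 0 Set.left_mem_uIcc).deriv]
  have hp := (hAC hT).integral_mul_deriv_eq_deriv_mul (hAC hT)
  have hb00 : b 0 = 0 := intervalIntegral.integral_same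
  simp only [mul_comm (deriv b _)] at hp
  rw [hI, ht]
  rw [hb00] at hp
  linarith

end WeakDerivative

section Difference

variable {n : ℕ} {u₀ : ℝ → E n} {u w v z : ℝ → ℝ → E n}

/-- The squared `L²` distance of two time slices. -/
def distSq (u v : ℝ → ℝ → E n) (t : ℝ) : ℝ≥0∞ := ∫⁻ x in circ, ‖u t x - v t x‖ₑ ^ 2

lemma measurable_distSq (hu : Measurable (Function.uncurry u)) (hv : Measurable (Function.uncurry v)) :
    Measurable (distSq u v) := by
  have h1 : Measurable fun p : ℝ × ℝ => u p.1 p.2 := hu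
  have h2 : Measurable fun p : ℝ × ℝ => v p.1 p.2 := hv
  have h : Measurable fun p : ℝ × ℝ => ‖u p.1 p.2 - v p.1 p.2‖ₑ ^ 2 := by fun_prop
  exact h.lintegral_prod_right'

lemma enorm_sub_sq_le (a b : E n) : ‖a - b‖ₑ ^ 2 ≤ 2 * (‖a‖ₑ ^ 2 + ‖b‖ₑ ^ 2) := by
  simp only [enorm_sq_eq_ofReal]
  rw [← ENNReal.ofReal_add (by positivity) (by positivity), two_mul,
    ← ENNReal.ofReal_add (by positivity) (by positivity)]
  refine ENNReal.ofReal_le_ofReal ?_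
  have := norm_sub_le a b
  nlinarith [norm_nonneg (a - b), sq_nonneg (‖a‖ - ‖b‖), norm_nonneg a, norm_nonneg b]

lemma lintegral_enorm_sub_sq_le {f g : ℝ → E n} (hf : Measurable f) :
    ∫⁻ x in circ, ‖f x - g x‖ₑ ^ 2
      ≤ 2 * ((∫⁻ x in circ, ‖f x‖ₑ ^ 2) + ∫⁻ x in circ, ‖g x‖ₑ ^ 2) := by
  rw [← lintegral_add_left (by fun_prop), ← lintegral_const_mul' _ _ (by simp)]
  exact lintegral_mono fun x => enorm_sub_sq_le _ _

lemma tendsto_distSq (hu : IsEnergySolAux n u₀ u w) (hv : IsEnergySolAux n u₀ v z)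
    (h0 : Measurable u₀) : Tendsto (distSq u v) (𝓝[>] 0) (𝓝 0) := by
  have h := ENNReal.Tendsto.const_mul (a := 2) (hu.init.add hv.init) (Or.inr (by simp))
  rw [add_zero, mul_zero] at h
  refine tendsto_of_tendsto_of_tendsto_of_le_of_le tendsto_const_nhds h (fun _ => zero_le) fun t => ?_
  have := hu.measurable_slice t
  refine le_trans (le_of_eq ?_) (lintegral_enorm_sub_sq_le (f := fun x => u t x - u₀ x)
    (g := fun x => v t x - u₀ x) (by fun_prop))
  simp only [sub_sub_sub_cancel_right]
  rfl

lemma ae_lintegral_sq_eq (hu : IsEnergySolAux n u₀ u w) :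
    ∀ᵐ t ∂timeMeasure, ∫⁻ x in circ, ‖u t x‖ₑ ^ 2 = volume circ := by
  filter_upwards [hu.ae_isState] with t ht
  rw [← setLIntegral_one]
  refine lintegral_congr_ae ?_
  filter_upwards [ht.sphere] with x hx
  rw [enorm_sq_eq_ofReal, hx]
  simp

lemma ae_distSq_le (hu : IsEnergySolAux n u₀ u w) (hv : IsEnergySolAux n u₀ v z) :
    ∀ᵐ t ∂timeMeasure, distSq u v t ≤ 2 * (volume circ + volume circ) := by
  filter_upwards [ae_lintegral_sq_eq hu, ae_lintegral_sq_eq hv] with t h1 h2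
  refine (lintegral_enorm_sub_sq_le (hu.measurable_slice t)).trans ?_
  rw [h1, h2]

lemma volume_circ_ne_top : volume circ ≠ ⊤ := by simp [circ]

lemma tsum_enorm_sq_fcR_le {f g : ℝ → E n} {i : Fin n}
    (h : MemLp (fun x => f x i - g x i) 2 circMeasure) :
    ∑' k, ‖fcR (fun x => f x i - g x i) k‖ₑ ^ 2
      ≤ ENNReal.ofReal (2 * π)⁻¹ * ∫⁻ x in circ, ‖f x - g x‖ₑ ^ 2 := by
  refine (tsum_enorm_sq_fc h.ofReal).le.trans ?_
  gcongr with x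
  rw [← ofReal_norm, ← ofReal_norm, RCLike.norm_ofReal]
  exact ENNReal.ofReal_le_ofReal (PiLp.norm_apply_le (f x - g x) i)

lemma ae_memLp_sub (hu : IsEnergySolAux n u₀ u w) (hv : IsEnergySolAux n u₀ v z) :
    ∀ᵐ t ∂timeMeasure, ∀ i, MemLp (fun x => u t x i - v t x i) 2 circMeasure := by
  filter_upwards [hu.ae_isState, hv.ae_isState] with t h1 h2 i
  exact (h1.memLp i).sub (h2.memLp i)

lemma ae_memLp_wsub (hu : IsEnergySolAux n u₀ u w) (hv : IsEnergySolAux n u₀ v z) :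
    ∀ᵐ t ∂timeMeasure, ∀ i, MemLp (fun x => w t x i - z t x i) 2 circMeasure := by
  filter_upwards [hu.ae_memLp_w, hv.ae_memLp_w] with t h1 h2 i
  exact (h1 i).sub (h2 i)

lemma ae_fcR_sub (hu : IsEnergySolAux n u₀ u w) (hv : IsEnergySolAux n u₀ v z) (k : ℤ) (i : Fin n) :
    ∀ᵐ t ∂timeMeasure, fcR (fun x => u t x i - v t x i) k = fcV (u t) k i - fcV (v t) k i := by
  filter_upwards [hu.ae_isState, hv.ae_isState] with t h1 h2
  exact fcR_sub ((h1.memLp i).integrable one_le_two) ((h2.memLp i).integrable one_le_two) k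

lemma ae_fcR_wsub (hu : IsEnergySolAux n u₀ u w) (hv : IsEnergySolAux n u₀ v z) (k : ℤ) (i : Fin n) :
    ∀ᵐ t ∂timeMeasure, fcR (fun x => w t x i - z t x i) k = fcV (w t) k i - fcV (z t) k i := by
  filter_upwards [hu.ae_memLp_w, hv.ae_memLp_w] with t h1 h2
  exact fcR_sub ((h1 i).integrable one_le_two) ((h2 i).integrable one_le_two) k

/-- The energy identity for a single Fourier mode of the difference. -/
lemma ae_mode_energy (hu : IsEnergySolAux n u₀ u w) (hv : IsEnergySolAux n u₀ v z)
    (h0 : Measurable u₀) (k : ℤ) (i : Fin n) :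
    ∀ᵐ t ∂timeMeasure, ‖fcR (fun x => u t x i - v t x i) k‖ ^ 2
      = 2 * ∫ s in 0..t, (fcR (fun x => u s x i - v s x i) k *
          (starRingEnd ℂ) (fcR (fun x => w s x i - z s x i) k)).re := by
  set A : ℝ → ℂ := fun t => fcV (u t) k i - fcV (v t) k i with hA
  set B : ℝ → ℂ := fun t => fcV (w t) k i - fcV (z t) k i with hB
  have mA : MemLp A ⊤ timeMeasure := (hu.memLp_top_fcV k i).sub (hv.memLp_top_fcV k i)
  have mB : MemLp B 2 timeMeasure := (hu.memLp_fcV_w k i).sub (hv.memLp_fcV_w k i)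
  have hm : Tendsto (fun t => √(distSq u v t).toReal) (𝓝[>] 0) (𝓝 0) := by
    have := (ENNReal.tendsto_toReal ENNReal.zero_ne_top).comp (tendsto_distSq hu hv h0)
    simpa [Function.comp_def] using (Real.continuous_sqrt.tendsto _).comp this
  have hbd : ∀ᵐ t ∂timeMeasure, ‖A t‖ ≤ √(distSq u v t).toReal := by
    filter_upwards [ae_distSq_le hu hv, ae_fcR_sub hu hv k i, ae_memLp_sub hu hv] with t h1 h2 h3
    have hfin : distSq u v t ≠ ⊤ := (h1.trans_lt (ENNReal.mul_lt_top (by simp)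
      (ENNReal.add_lt_top.2 ⟨volume_circ_ne_top.lt_top, volume_circ_ne_top.lt_top⟩))).ne
    refine Real.le_sqrt_of_sq_le ?_
    rw [← ENNReal.ofReal_le_iff_le_toReal hfin, ← enorm_sq_eq_ofReal]
    simp only [hA, ← h2]
    refine (ENNReal.le_tsum k).trans ((tsum_enorm_sq_fcR_le (h3 i)).trans ?_)
    refine mul_le_of_le_one_left zero_le ?_
    rw [ENNReal.ofReal_le_one]
    exact inv_le_one_of_one_le₀ (by linarith [pi_gt_three])
  have key : ∀ ζ : ℂ, ‖ζ‖ = 1 → ∀ᵐ t ∂timeMeasure, (A t * (starRingEnd ℂ) ζ).re ^ 2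
      = 2 * ∫ s in 0..t, (A s * (starRingEnd ℂ) ζ).re * (B s * (starRingEnd ℂ) ζ).re := by
    intro ζ hζ
    have hre : ∀ {f : ℝ → ℂ}, LocallyIntegrable f timeMeasure →
        LocallyIntegrable (fun t => (f t * (starRingEnd ℂ) ζ).re) timeMeasure := by
      intro f hf x
      obtain ⟨s, hs, h⟩ := hf x
      exact ⟨s, hs, (h.mul_const _).re⟩
    refine ae_sq_eq_integral (hre (mA.locallyIntegrable le_top)) (hre (mB.locallyIntegrable one_le_two))
      (fun η h1 h2 h3 => ?_) hm ?_
    · have e1 := hu.weakDeriv_mode k i ζ h1 h2 h3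
      have e2 := hv.weakDeriv_mode k i ζ h1 h2 h3
      have hdc : Continuous (deriv η) := h1.continuous_deriv (by simp)
      have i1 : Integrable (fun t => deriv η t * (fcV (u t) k i * (starRingEnd ℂ) ζ).re) timeMeasure :=
        (hre ((hu.memLp_top_fcV k i).locallyIntegrable le_top)).integrable_smul_left_of_hasCompactSupport
          hdc h2.deriv
      have i2 : Integrable (fun t => deriv η t * (fcV (v t) k i * (starRingEnd ℂ) ζ).re) timeMeasure :=
        (hre ((hv.memLp_top_fcV k i).locallyIntegrable le_top)).integrable_smul_left_of_hasCompactSupport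
          hdc h2.deriv
      have i3 : Integrable (fun t => η t * (fcV (w t) k i * (starRingEnd ℂ) ζ).re) timeMeasure :=
        (hre ((hu.memLp_fcV_w k i).locallyIntegrable one_le_two)).integrable_smul_left_of_hasCompactSupport
          h1.continuous h2
      have i4 : Integrable (fun t => η t * (fcV (z t) k i * (starRingEnd ℂ) ζ).re) timeMeasure :=
        (hre ((hv.memLp_fcV_w k i).locallyIntegrable one_le_two)).integrable_smul_left_of_hasCompactSupport
          h1.continuous h2
      simp only [hA, hB, sub_mul, Complex.sub_re, mul_sub]
      rw [integral_sub i1 i2, integral_sub i3 i4, e1, e2]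
      ring
    · filter_upwards [hbd] with t ht
      refine (Complex.abs_re_le_norm _).trans ?_
      rwa [norm_mul, RCLike.norm_conj, hζ, mul_one]
  have hint : ∀ {T : ℝ}, 0 ≤ T → IntervalIntegrable (fun t => (A t).re * (B t).re) volume 0 T :=
    fun hT => intervalIntegrable_of_timeMeasure
      (((mB.re.mul mA.re : MemLp _ 2 timeMeasure)).locallyIntegrable one_le_two) hT
  have hint' : ∀ {T : ℝ}, 0 ≤ T → IntervalIntegrable (fun t => (A t).im * (B t).im) volume 0 T :=
    fun hT => intervalIntegrable_of_timeMeasure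
      (((mB.im.mul mA.im : MemLp _ 2 timeMeasure)).locallyIntegrable one_le_two) hT
  have k1 := key 1 (by simp)
  have k2 := key Complex.I (by simp)
  simp only [map_one, mul_one] at k1
  simp only [Complex.conj_I, mul_neg, Complex.neg_re, Complex.mul_I_re, neg_neg] at k2
  filter_upwards [k1, k2, ae_fcR_sub hu hv k i, ae_restrict_mem measurableSet_Ioi] with t h1 h2 h3 ht
  have ht' : (0 : ℝ) ≤ t := le_of_lt ht
  have he : ∫ s in 0..t, (fcR (fun x => u s x i - v s x i) k *
      (starRingEnd ℂ) (fcR (fun x => w s x i - z s x i) k)).re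
      = ∫ s in 0..t, (A s).re * (B s).re + (A s).im * (B s).im := by
    rw [intervalIntegral.integral_of_le ht', intervalIntegral.integral_of_le ht']
    refine integral_congr_ae ?_
    filter_upwards [ae_restrict_of_ae_restrict_of_subset Set.Ioc_subset_Ioi_self (ae_fcR_sub hu hv k i),
      ae_restrict_of_ae_restrict_of_subset Set.Ioc_subset_Ioi_self (ae_fcR_wsub hu hv k i)] with s a1 a2
    rw [a1, a2]
    simp [hA, hB]
    ring
  rw [he, intervalIntegral.integral_add (hint ht') (hint' ht'), mul_add, ← h1, ← h2, h3,
    ← Complex.normSq_eq_norm_sq, Complex.normSq_apply]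
  ring

end Difference

/-- A Grönwall inequality with an integrable coefficient. -/
lemma ae_eq_zero_of_le_integral {a y : ℝ → ℝ} (ha : LocallyIntegrable a timeMeasure)
    (hay : LocallyIntegrable (fun t => a t * y t) timeMeasure) (ha0 : ∀ t, 0 ≤ a t)
    (hy0 : ∀ t, 0 ≤ y t) (h : ∀ᵐ t ∂timeMeasure, y t ≤ ∫ s in 0..t, a s * y s) :
    ∀ᵐ t ∂timeMeasure, y t = 0 := by
  set Y : ℝ → ℝ := fun t => ∫ s in 0..t, a s * y s with hY
  have hI : ∀ {f : ℝ → ℝ}, LocallyIntegrable f timeMeasure → ∀ {p q : ℝ}, 0 ≤ p → 0 ≤ q →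
      IntervalIntegrable f volume p q := fun hf _ _ hp hq =>
    (intervalIntegrable_of_timeMeasure hf hp).symm.trans (intervalIntegrable_of_timeMeasure hf hq)
  have hsub : ∀ {f : ℝ → ℝ}, LocallyIntegrable f timeMeasure → ∀ {p q : ℝ}, 0 ≤ p → 0 ≤ q →
      (∫ s in 0..q, f s) - ∫ s in 0..p, f s = ∫ s in p..q, f s := fun hf _ _ hp hq =>
    intervalIntegral.integral_interval_sub_left (hI hf le_rfl hq) (hI hf le_rfl hp)
  have hmono : ∀ {p q : ℝ}, 0 ≤ p → p ≤ q → Y p ≤ Y q := fun hp hpq =>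
    sub_nonneg.1 (by
      rw [hsub hay hp (hp.trans hpq)]
      exact intervalIntegral.integral_nonneg_of_forall hpq fun s => mul_nonneg (ha0 s) (hy0 s))
  have hYc : ContinuousOn Y (Set.Ici 0) := continuousOn_primitive hay
  have hY0 : Y 0 = 0 := intervalIntegral.integral_same
  have hzero : ∀ {T : ℝ}, 0 ≤ T → Set.Icc 0 T ⊆ Y ⁻¹' {0} := by
    intro T hT
    refine IsClosed.Icc_subset_of_forall_exists_gt ?_ hY0 fun p hp q hq => ?_
    · rw [Set.inter_comm]
      exact (hYc.mono Set.Icc_subset_Ici_self).preimage_isClosed_of_isClosed isClosed_Icc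
        isClosed_singleton
    · have hp0 : 0 ≤ p := hp.2.1
      have hpY : Y p = 0 := hp.1
      have hc : Tendsto (fun t => ∫ s in 0..t, a s) (𝓝[>] p) (𝓝 (∫ s in 0..p, a s)) :=
        ((continuousOn_primitive ha) p hp0).mono_left
          (nhdsWithin_mono _ fun t ht => hp0.trans (le_of_lt ht))
      have hev := (hc.eventually (gt_mem_nhds
        (show ∫ s in 0..p, a s < (∫ s in 0..p, a s) + 1 by linarith))).and
        (Ioc_mem_nhdsGT hq)
      obtain ⟨r, hr1, hr2⟩ := hev.exists
      refine ⟨r, ?_, hr2⟩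
      have hr0 : 0 ≤ r := hp0.trans hr2.1.le
      have e1 : ∫ s in p..r, a s < 1 := by
        rw [← hsub ha hp0 hr0]; linarith
      have e2 : Y r ≤ ∫ s in p..r, a s * Y r := by
        have : Y r = ∫ s in p..r, a s * y s := by rw [← hsub hay hp0 hr0]; linarith
        conv_lhs => rw [this]
        refine intervalIntegral.integral_mono_ae_restrict hr2.1.le (hI hay hp0 hr0)
          ((hI ha hp0 hr0).mul_const _) ?_
        have hb := ae_restrict_of_ae_restrict_of_subset (s := Set.Ioc p r)
          (fun t ht => lt_of_le_of_lt hp0 ht.1) h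
        rw [EventuallyLE, ← restrict_Ioc_eq_restrict_Icc]
        filter_upwards [hb, ae_restrict_mem measurableSet_Ioc] with s h1 h2
        exact mul_le_mul_of_nonneg_left (h1.trans (hmono (hp0.trans h2.1.le) h2.2)) (ha0 s)
      rw [intervalIntegral.integral_mul_const] at e2
      have e3 : 0 ≤ Y r := hpY ▸ hmono hp0 hr2.1.le
      have : Y r = 0 := by nlinarith
      exact this
  filter_upwards [h, ae_restrict_mem measurableSet_Ioi] with t h1 h2
  have h3 : Y t = 0 := hzero (le_of_lt h2) ⟨le_of_lt h2, le_rfl⟩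
  exact le_antisymm (h1.trans h3.le) (hy0 t)

section Uniqueness

variable {n : ℕ} {u₀ : ℝ → E n} {u w v z : ℝ → ℝ → E n}

lemma enorm_mul_le_add_sq {a b c d : ℝ} {r : ℝ} (h : |r| ≤ a * b) (hac : |a| ≤ c) (hbd : |b| ≤ d) :
    ‖r‖ₑ ≤ ENNReal.ofReal (c ^ 2) + ENNReal.ofReal (d ^ 2) := by
  rw [← ENNReal.ofReal_add (by positivity) (by positivity), Real.enorm_eq_ofReal_abs]
  refine ENNReal.ofReal_le_ofReal ?_
  nlinarith [sq_nonneg (a - b), sq_le_sq' (abs_le.1 hac).1 (abs_le.1 hac).2,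
    sq_le_sq' (abs_le.1 hbd).1 (abs_le.1 hbd).2, sq_nonneg (a + b), sq_nonneg a, sq_nonneg b]

lemma lintegral_distSq_Ioc_lt_top (hu : IsEnergySolAux n u₀ u w) (hv : IsEnergySolAux n u₀ v z)
    (t : ℝ) : ∫⁻ s in Set.Ioc 0 t, distSq u v s < ⊤ := by
  refine (lintegral_mono_ae (ae_restrict_of_ae_restrict_of_subset Set.Ioc_subset_Ioi_self
    (ae_distSq_le hu hv))).trans_lt ?_
  rw [lintegral_const]
  refine ENNReal.mul_lt_top (ENNReal.mul_lt_top (by simp)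
    (ENNReal.add_lt_top.2 ⟨volume_circ_ne_top.lt_top, volume_circ_ne_top.lt_top⟩)) (by simp)

lemma lintegral_distSq_wsub_lt_top (hu : IsEnergySolAux n u₀ u w) (hv : IsEnergySolAux n u₀ v z) :
    ∫⁻ s in Set.Ioi (0 : ℝ), distSq w z s < ⊤ := by
  refine (lintegral_mono fun t => lintegral_enorm_sub_sq_le (hu.measurable_wslice t)).trans_lt ?_
  rw [lintegral_const_mul' _ _ (by simp), lintegral_add_left hu.measurable_lintegral_w]
  exact ENNReal.mul_lt_top (by simp) (ENNReal.add_lt_top.2 ⟨hu.wL2, hv.wL2⟩)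

lemma lintegral_distSq_add_lt_top (hu : IsEnergySolAux n u₀ u w) (hv : IsEnergySolAux n u₀ v z)
    (t : ℝ) : ∫⁻ s in Set.Ioc 0 t, (distSq u v s + distSq w z s) < ⊤ := by
  rw [lintegral_add_left (measurable_distSq hu.meas hv.meas)]
  exact ENNReal.add_lt_top.2 ⟨lintegral_distSq_Ioc_lt_top hu hv t,
    (lintegral_mono_set Set.Ioc_subset_Ioi_self).trans_lt (lintegral_distSq_wsub_lt_top hu hv)⟩

lemma measurable_uncurry_sub_apply (hu : Measurable (Function.uncurry u))
    (hv : Measurable (Function.uncurry v)) (i : Fin n) :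
    Measurable (Function.uncurry fun t x => u t x i - v t x i) := by
  have h1 : Measurable fun p : ℝ × ℝ => u p.1 p.2 := hu
  have h2 : Measurable fun p : ℝ × ℝ => v p.1 p.2 := hv
  change Measurable fun p : ℝ × ℝ => u p.1 p.2 i - v p.1 p.2 i
  fun_prop

lemma integrableOn_integral_mul (hu : IsEnergySolAux n u₀ u w) (hv : IsEnergySolAux n u₀ v z)
    (i : Fin n) (t : ℝ) :
    IntegrableOn (fun s => ∫ x in circ, (u s x i - v s x i) * (w s x i - z s x i)) (Set.Ioc 0 t) := by
  have m1 : Measurable fun p : ℝ × ℝ => u p.1 p.2 i - v p.1 p.2 i :=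
    measurable_uncurry_sub_apply hu.meas hv.meas i
  have m2 : Measurable fun p : ℝ × ℝ => w p.1 p.2 i - z p.1 p.2 i :=
    measurable_uncurry_sub_apply hu.wMeas hv.wMeas i
  have m : Measurable fun p : ℝ × ℝ => (u p.1 p.2 i - v p.1 p.2 i) * (w p.1 p.2 i - z p.1 p.2 i) := by
    fun_prop
  refine ⟨(StronglyMeasurable.integral_prod_right' (f := fun p : ℝ × ℝ =>
    (u p.1 p.2 i - v p.1 p.2 i) * (w p.1 p.2 i - z p.1 p.2 i))
      m.stronglyMeasurable).aestronglyMeasurable,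
    (lintegral_mono fun s => ?_).trans_lt (lintegral_distSq_add_lt_top hu hv t)⟩
  refine (enorm_integral_le_lintegral_enorm _).trans ?_
  have := hu.measurable_slice s
  have := hv.measurable_slice s
  rw [distSq, distSq, ← lintegral_add_left (by fun_prop)]
  refine lintegral_mono fun x => ?_
  rw [enorm_sq_eq_ofReal, enorm_sq_eq_ofReal]
  refine enorm_mul_le_add_sq (abs_mul _ _).le ?_ ?_
  · rw [abs_abs]; exact PiLp.norm_apply_le (u s x - v s x) i
  · rw [abs_abs]; exact PiLp.norm_apply_le (w s x - z s x) i

/-- The energy identity for a component of the difference. -/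
lemma ae_component_energy (hu : IsEnergySolAux n u₀ u w) (hv : IsEnergySolAux n u₀ v z)
    (h0 : Measurable u₀) (i : Fin n) :
    ∀ᵐ t ∂timeMeasure, ∫ x in circ, (u t x i - v t x i) ^ 2
      = 2 * ∫ s in 0..t, ∫ x in circ, (u s x i - v s x i) * (w s x i - z s x i) := by
  set F : ℤ → ℝ → ℝ := fun k s => (fcR (fun x => u s x i - v s x i) k *
    (starRingEnd ℂ) (fcR (fun x => w s x i - z s x i) k)).re with hF
  have hFm : ∀ k, Measurable (F k) := fun k => by
    have m1 := measurable_fcR_kernel (measurable_uncurry_sub_apply hu.meas hv.meas i) k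
    have m2 := measurable_fcR_kernel (measurable_uncurry_sub_apply hu.wMeas hv.wMeas i) k
    exact Complex.measurable_re.comp (m1.mul (Complex.continuous_conj.measurable.comp m2))
  have hmem := ae_memLp_sub hu hv
  have hwmem := ae_memLp_wsub hu hv
  have hFb : ∀ᵐ s ∂timeMeasure, ∑' k, ‖F k s‖ₑ ≤ distSq u v s + distSq w z s := by
    have h1 : ENNReal.ofReal (2 * π)⁻¹ ≤ 1 := by
      rw [ENNReal.ofReal_le_one]
      exact inv_le_one_of_one_le₀ (by linarith [pi_gt_three])
    filter_upwards [hmem, hwmem] with s a1 a2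
    calc ∑' k, ‖F k s‖ₑ ≤ ∑' k, (‖fcR (fun x => u s x i - v s x i) k‖ₑ ^ 2
          + ‖fcR (fun x => w s x i - z s x i) k‖ₑ ^ 2) := by
          refine ENNReal.tsum_le_tsum fun k => ?_
          rw [enorm_sq_eq_ofReal, enorm_sq_eq_ofReal]
          refine enorm_mul_le_add_sq ((Complex.abs_re_le_norm _).trans ?_) (abs_norm _).le
            (abs_norm _).le
          rw [norm_mul, RCLike.norm_conj]
      _ ≤ _ := by
          rw [ENNReal.tsum_add]
          exact add_le_add
            ((tsum_enorm_sq_fcR_le (a1 i)).trans (mul_le_of_le_one_left zero_le h1))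
            ((tsum_enorm_sq_fcR_le (a2 i)).trans (mul_le_of_le_one_left zero_le h1))
  have hmodes := ae_all_iff.2 fun k => ae_mode_energy hu hv h0 k i
  filter_upwards [hmodes, hmem, ae_restrict_mem measurableSet_Ioi] with t h1 h2 ht
  have ht' : (0 : ℝ) ≤ t := le_of_lt ht
  have hfin : ∑' k, ∫⁻ s in Set.Ioc 0 t, ‖F k s‖ₑ ≠ ⊤ := by
    rw [← lintegral_tsum fun k => (hFm k).enorm.aemeasurable]
    exact ((lintegral_mono_ae (ae_restrict_of_ae_restrict_of_subset Set.Ioc_subset_Ioi_self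
      hFb)).trans_lt (lintegral_distSq_add_lt_top hu hv t)).ne
  have hsum := integral_tsum (fun k => (hFm k).aestronglyMeasurable) hfin
  have hpar := (hasSum_sq_fcR (h2 i)).tsum_eq
  simp only [h1, intervalIntegral.integral_of_le ht'] at hpar
  rw [tsum_mul_left, ← hsum] at hpar
  have hinner : ∫ s in Set.Ioc 0 t, ∑' k, F k s
      = (2 * π)⁻¹ * ∫ s in Set.Ioc 0 t, ∫ x in circ, (u s x i - v s x i) * (w s x i - z s x i) := by
    rw [← integral_const_mul]
    refine integral_congr_ae ?_
    filter_upwards [ae_restrict_of_ae_restrict_of_subset Set.Ioc_subset_Ioi_self hmem,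
      ae_restrict_of_ae_restrict_of_subset Set.Ioc_subset_Ioi_self hwmem] with s a1 a2
    exact (hasSum_inner_fcR (a1 i) (a2 i)).tsum_eq
  rw [hinner] at hpar
  rw [intervalIntegral.integral_of_le ht']
  have hpi : (2 * π)⁻¹ ≠ 0 := by positivity
  refine mul_left_cancel₀ hpi ?_
  rw [← hpar]
  ring

lemma sum_integral_sq_eq {f : ℝ → E n} (hf : Measurable f)
    (h : ∀ i, MemLp (fun x => f x i) 2 circMeasure) :
    ∑ i, ∫ x in circ, f x i ^ 2 = (∫⁻ x in circ, ‖f x‖ₑ ^ 2).toReal := by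
  rw [← integral_finsetSum _ fun i _ => (h i).integrable_sq]
  simp only [enorm_sq_eq_ofReal]
  rw [← integral_eq_lintegral_of_nonneg_ae (ae_of_all _ fun x => by positivity)
    (hf.norm.pow_const 2).aestronglyMeasurable]
  refine integral_congr_ae (ae_of_all _ fun x => ?_)
  simp only [EuclideanSpace.norm_sq_eq, Real.norm_eq_abs, sq_abs]

lemma integrable_toReal_lintegral_w (hu : IsEnergySolAux n u₀ u w) :
    Integrable (fun t => (∫⁻ x in circ, ‖w t x‖ₑ ^ 2).toReal) timeMeasure :=
  integrable_toReal_of_lintegral_ne_top hu.measurable_lintegral_w.aemeasurable hu.wL2.ne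

/-- The differential inequality for the distance of two solutions, in integrated form. -/
lemma ae_distSq_le_integral (hu : IsEnergySolAux n u₀ u w) (hv : IsEnergySolAux n u₀ v z)
    (h0 : Measurable u₀) (hus : ∀ᵐ t ∂timeMeasure, IsSlice (u t) (w t))
    (hvs : ∀ᵐ t ∂timeMeasure, IsSlice (v t) (z t)) {a : ℝ → ℝ}
    (ha : a = fun t => 4 / π ^ 2 * ((∫⁻ x in circ, ‖w t x‖ₑ ^ 2).toReal
      + (∫⁻ x in circ, ‖z t x‖ₑ ^ 2).toReal))
    (hint : LocallyIntegrable (fun t => a t * (distSq u v t).toReal) timeMeasure) :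
    ∀ᵐ t ∂timeMeasure, (distSq u v t).toReal ≤ ∫ s in 0..t, a s * (distSq u v s).toReal := by
  have hN : ∀ᵐ t ∂timeMeasure, ∑ i, ∫ x in circ, (u t x i - v t x i) ^ 2 = (distSq u v t).toReal := by
    filter_upwards [ae_memLp_sub hu hv] with t ht
    exact sum_integral_sq_eq (f := fun x => u t x - v t x)
      ((hu.measurable_slice t).sub (hv.measurable_slice t)) ht
  have hle : ∀ᵐ t ∂timeMeasure,
      2 * ∑ i, ∫ x in circ, (u t x i - v t x i) * (w t x i - z t x i)
        ≤ a t * (distSq u v t).toReal := by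
    filter_upwards [hN, hus, hvs] with t h1 h2 h3
    have e1 := h2.sum_integral_sub_mul_le h3
    have e2 := h2.hOne_le
    have e3 := h3.hOne_le
    rw [sum_integral_sq_eq (hu.measurable_wslice t) h2.wMemLp] at e2
    rw [sum_integral_sq_eq (hv.measurable_wslice t) h3.wMemLp] at e3
    rw [h1] at e1
    have e4 : 8 * π * (hOne (u t) + hOne (v t)) ≤ a t := by
      have hpi := pi_pos
      rw [ha]
      simp only
      rw [div_mul_eq_mul_div, le_div_iff₀ (by positivity)]
      nlinarith
    have := mul_le_mul_of_nonneg_right e4 (ENNReal.toReal_nonneg (a := distSq u v t))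
    linarith
  filter_upwards [hN, ae_all_iff.2 (ae_component_energy hu hv h0),
    ae_restrict_mem measurableSet_Ioi] with t h1 h2 ht
  have ht' : (0 : ℝ) ≤ t := le_of_lt ht
  rw [← h1, Finset.sum_congr rfl fun i _ => h2 i, ← Finset.mul_sum]
  simp only [intervalIntegral.integral_of_le ht']
  rw [← integral_finsetSum _ fun i _ => integrableOn_integral_mul hu hv i t, ← integral_const_mul]
  refine integral_mono_ae ?_ ?_
    (ae_restrict_of_ae_restrict_of_subset Set.Ioc_subset_Ioi_self hle)
  · exact (integrable_finsetSum _ fun i _ => integrableOn_integral_mul hu hv i t).const_mul 2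
  · exact (intervalIntegrable_iff_integrableOn_Ioc_of_le ht').1
      (intervalIntegrable_of_timeMeasure hint ht')

/-- Uniqueness for solutions with regular time slices. -/
lemma ae_eq_of_isSlice (hu : IsEnergySolAux n u₀ u w) (hv : IsEnergySolAux n u₀ v z)
    (h0 : Measurable u₀) (hus : ∀ᵐ t ∂timeMeasure, IsSlice (u t) (w t))
    (hvs : ∀ᵐ t ∂timeMeasure, IsSlice (v t) (z t)) :
    ∀ᵐ p ∂STmeasure, u p.1 p.2 = v p.1 p.2 := by
  have m1 : Measurable fun p : ℝ × ℝ => u p.1 p.2 := hu.meas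
  have m2 : Measurable fun p : ℝ × ℝ => v p.1 p.2 := hv.meas
  set a : ℝ → ℝ := fun t => 4 / π ^ 2 * ((∫⁻ x in circ, ‖w t x‖ₑ ^ 2).toReal
      + (∫⁻ x in circ, ‖z t x‖ₑ ^ 2).toReal) with ha
  have hai : Integrable a timeMeasure :=
    ((integrable_toReal_lintegral_w hu).add (integrable_toReal_lintegral_w hv)).const_mul _
  have hC : 2 * (volume circ + volume circ) ≠ ⊤ := ENNReal.mul_ne_top (by simp)
    (ENNReal.add_ne_top.2 ⟨volume_circ_ne_top, volume_circ_ne_top⟩)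
  have hint : Integrable (fun t => a t * (distSq u v t).toReal) timeMeasure := by
    refine hai.mul_bdd (c := (2 * (volume circ + volume circ)).toReal)
      (measurable_distSq hu.meas hv.meas).ennreal_toReal.aestronglyMeasurable ?_
    filter_upwards [ae_distSq_le hu hv] with t ht
    rw [Real.norm_eq_abs, abs_of_nonneg ENNReal.toReal_nonneg]
    exact ENNReal.toReal_mono hC ht
  have hzero := ae_eq_zero_of_le_integral hai.locallyIntegrable hint.locallyIntegrable
    (fun t => by positivity) (fun t => ENNReal.toReal_nonneg)
    (ae_distSq_le_integral hu hv h0 hus hvs ha hint.locallyIntegrable)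
  refine (Measure.ae_prod_iff_ae_ae (measurableSet_eq_fun m1 m2)).2 ?_
  filter_upwards [hzero, ae_distSq_le hu hv] with t h1 h2
  have h3 : distSq u v t = 0 :=
    ((ENNReal.toReal_eq_zero_iff _).1 h1).resolve_right (h2.trans_lt hC.lt_top).ne
  have hm : Measurable fun x => ‖u t x - v t x‖ₑ ^ 2 :=
    ((hu.measurable_slice t).sub (hv.measurable_slice t)).enorm.pow_const 2
  rw [distSq, lintegral_eq_zero_iff hm] at h3
  filter_upwards [h3] with x hx
  simpa [sub_eq_zero] using hx

end Uniqueness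

/-- Uniqueness of small-energy energy-class solutions that are in
`H¹(S¹)` for a.e. time. -/
theorem uniqueness_small_energy_H1 (n : ℕ) (hn : 2 ≤ n) :
    ∃ ε : ℝ, 0 < ε ∧
      ∀ u₀ : ℝ → E n, Measurable u₀ → Function.Periodic u₀ (2 * π) →
        (∀ x, ‖u₀ x‖ = 1) →
        ∀ u v : ℝ → ℝ → E n,
          IsEnergySol n u₀ u → IsEnergySol n u₀ v →
          (∀ᵐ t ∂(volume.restrict (Set.Ioi (0 : ℝ))), hSob 1 (u t) < ⊤) →
          (∀ᵐ t ∂(volume.restrict (Set.Ioi (0 : ℝ))), hSob 1 (v t) < ⊤) →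
          (∀ᵐ t ∂(volume.restrict (Set.Ioi (0 : ℝ))), hHalf (u t) ≤ ENNReal.ofReal (ε ^ 2)) →
          (∀ᵐ t ∂(volume.restrict (Set.Ioi (0 : ℝ))), hHalf (v t) ≤ ENNReal.ofReal (ε ^ 2)) →
          ∀ᵐ p ∂STmeasure, u p.1 p.2 = v p.1 p.2 := by
  refine ⟨1 / 4, by norm_num, fun u₀ h0 _ _ u v hu hv hu1 hv1 hus hvs => ?_⟩
  obtain ⟨w, hu⟩ := hu
  obtain ⟨z, hv⟩ := hv
  rw [show ((1 : ℝ) / 4) ^ 2 = 1 / 16 by norm_num] at hus hvs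
  exact ae_eq_of_isSlice hu hv h0 (hu.ae_isSlice hu1 hus) (hv.ae_isSlice hv1 hvs)
end
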